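/- arXiv:0903.3068 — 2 statements merged into one kernel-verified Lean document; each statement's English description precedes it below -/
import Mathlib

section
/- Suppose u, v ∈ C(ℝⁿ) and α ∈ ℝ satisfy, in the viscosity sense, F(D²u) − (1/2) y·Du − αu ≤ 0 in ℝⁿ and F(D²v) − (1/2) y·Dv − αv ≥ 0 in ℝⁿ. Suppose also that v > 0 everywhere and that u(y) ≤ C exp(−a|y|^p) for some constants C, a > 0 and p > 1 and every y ∈ ℝⁿ. Then either u ≤ 0 in ℝⁿ, or u ≡ tv for some constant t > 0. -/
noncomputable section

open Filter Matrix Real Set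
open scoped Topology

/-- Euclidean `n`-space `ℝⁿ`. -/
abbrev En (n : ℕ) := EuclideanSpace ℝ (Fin n)

/-- `n × n` real matrices. -/
abbrev Mat (n : ℕ) := Matrix (Fin n) (Fin n) ℝ

/-- The set of symmetric positive definite matrices whose eigenvalues all lie in `[lam, Lam]`. -/
def PucciMatrices (n : ℕ) (lam Lam : ℝ) : Set (Mat n) :=
  { A | ∃ hA : A.IsHermitian, ∀ i, hA.eigenvalues i ∈ Set.Icc lam Lam }

/-- The Pucci maximal operator `P⁺(M) = sup {-tr(AM) : A ∈ PucciMatrices}`. -/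
def PucciPlus (n : ℕ) (lam Lam : ℝ) (M : Mat n) : ℝ :=
  sSup ((fun A => -(A * M).trace) '' PucciMatrices n lam Lam)

/-- The Pucci minimal operator `P⁻(M) = inf {-tr(AM) : A ∈ PucciMatrices}`. -/
def PucciMinus (n : ℕ) (lam Lam : ℝ) (M : Mat n) : ℝ :=
  sInf ((fun A => -(A * M).trace) '' PucciMatrices n lam Lam)

/-- `F` is uniformly elliptic with ellipticity constants `lam ≤ Lam`. -/
def UniformlyElliptic (n : ℕ) (lam Lam : ℝ) (F : Mat n → ℝ) : Prop :=
  ∀ M N : Mat n, M.IsSymm → N.IsSymm →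
    PucciMinus n lam Lam (M - N) ≤ F M - F N ∧ F M - F N ≤ PucciPlus n lam Lam (M - N)

/-- `F` is positively homogeneous of order one. -/
def PositivelyHomogeneous (n : ℕ) (F : Mat n → ℝ) : Prop :=
  ∀ (M : Mat n), ∀ η : ℝ, 0 ≤ η → F (η • M) = η * F M

/-- The Hessian matrix of `φ : ℝⁿ → ℝ` at a point `y`. -/
def hess (n : ℕ) (φ : En n → ℝ) (y : En n) : Mat n :=
  Matrix.of fun i j =>
    fderiv ℝ (fun z => fderiv ℝ φ z (EuclideanSpace.single j 1)) y (EuclideanSpace.single i 1)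

/-- Viscosity subsolution of the elliptic equation `G(D²u, Du, u, y) = 0` on `Ω`,
i.e. `G[u] ≤ 0` in the viscosity sense. -/
def ViscSubE (n : ℕ) (Ω : Set (En n))
    (G : Mat n → (En n →L[ℝ] ℝ) → ℝ → En n → ℝ) (u : En n → ℝ) : Prop :=
  ∀ y ∈ Ω, ∀ φ : En n → ℝ, ContDiff ℝ 2 φ →
    IsLocalMaxOn (fun z => u z - φ z) Ω y →
    G (hess n φ y) (fderiv ℝ φ y) (u y) y ≤ 0

/-- Viscosity supersolution of the elliptic equation `G(D²u, Du, u, y) = 0` on `Ω`,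
i.e. `G[u] ≥ 0` in the viscosity sense. -/
def ViscSupE (n : ℕ) (Ω : Set (En n))
    (G : Mat n → (En n →L[ℝ] ℝ) → ℝ → En n → ℝ) (u : En n → ℝ) : Prop :=
  ∀ y ∈ Ω, ∀ φ : En n → ℝ, ContDiff ℝ 2 φ →
    IsLocalMinOn (fun z => u z - φ z) Ω y →
    0 ≤ G (hess n φ y) (fderiv ℝ φ y) (u y) y

/-- Viscosity solution of the elliptic equation `G(D²u, Du, u, y) = 0` on `Ω`. -/
def ViscSolE (n : ℕ) (Ω : Set (En n))
    (G : Mat n → (En n →L[ℝ] ℝ) → ℝ → En n → ℝ) (u : En n → ℝ) : Prop :=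
  ViscSubE n Ω G u ∧ ViscSupE n Ω G u

/-- Time derivative of `φ : ℝⁿ × ℝ → ℝ` at `p = (x, t)`. -/
def tderiv (n : ℕ) (φ : En n × ℝ → ℝ) (p : En n × ℝ) : ℝ :=
  deriv (fun s => φ (p.1, s)) p.2

/-- Spatial Hessian of `φ : ℝⁿ × ℝ → ℝ` at `p = (x, t)`. -/
def shess (n : ℕ) (φ : En n × ℝ → ℝ) (p : En n × ℝ) : Mat n :=
  hess n (fun z => φ (z, p.2)) p.1

/-- Spatial differential of `φ : ℝⁿ × ℝ → ℝ` at `p = (x, t)`. -/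
def sgrad (n : ℕ) (φ : En n × ℝ → ℝ) (p : En n × ℝ) : En n →L[ℝ] ℝ :=
  fderiv ℝ (fun z => φ (z, p.2)) p.1

/-- Viscosity subsolution of the parabolic equation `u_t + G(D²u, Du, u, (x,t)) = 0` on `Ω`. -/
def ViscSubP (n : ℕ) (Ω : Set (En n × ℝ))
    (G : Mat n → (En n →L[ℝ] ℝ) → ℝ → En n × ℝ → ℝ) (u : En n × ℝ → ℝ) : Prop :=
  ∀ p ∈ Ω, ∀ φ : En n × ℝ → ℝ, ContDiff ℝ 2 φ →
    IsLocalMaxOn (fun q => u q - φ q) Ω p →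
    tderiv n φ p + G (shess n φ p) (sgrad n φ p) (u p) p ≤ 0

/-- Viscosity supersolution of the parabolic equation `u_t + G(D²u, Du, u, (x,t)) = 0` on `Ω`. -/
def ViscSupP (n : ℕ) (Ω : Set (En n × ℝ))
    (G : Mat n → (En n →L[ℝ] ℝ) → ℝ → En n × ℝ → ℝ) (u : En n × ℝ → ℝ) : Prop :=
  ∀ p ∈ Ω, ∀ φ : En n × ℝ → ℝ, ContDiff ℝ 2 φ →
    IsLocalMinOn (fun q => u q - φ q) Ω p →
    0 ≤ tderiv n φ p + G (shess n φ p) (sgrad n φ p) (u p) p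

/-- Viscosity solution of the parabolic equation `u_t + G(D²u, Du, u, (x,t)) = 0` on `Ω`. -/
def ViscSolP (n : ℕ) (Ω : Set (En n × ℝ))
    (G : Mat n → (En n →L[ℝ] ℝ) → ℝ → En n × ℝ → ℝ) (u : En n × ℝ → ℝ) : Prop :=
  ViscSubP n Ω G u ∧ ViscSupP n Ω G u

/-- The parabolic domain `ℝⁿ × ℝ₊`. -/
def Qset (n : ℕ) : Set (En n × ℝ) := {p | 0 < p.2}

/-- The elliptic operator `F(D²u) - (1/2) y·Du - α u - f(y)`. -/
def Fop (n : ℕ) (F : Mat n → ℝ) (α : ℝ) (f : En n → ℝ) :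
    Mat n → (En n →L[ℝ] ℝ) → ℝ → En n → ℝ :=
  fun M p v y => F M - (1/2) * p y - α * v - f y

/-- Membership in the space `X` with weight `b`: continuity and finiteness of the norm. -/
def memX (n : ℕ) (b : ℝ) (u : En n → ℝ) : Prop :=
  Continuous u ∧ BddAbove (Set.range fun y : En n => |u y| * Real.exp (b * ‖y‖ ^ 2) / (1 + ‖y‖ ^ 2))

/-- The norm `‖u‖_X = sup_y |u(y)| e^{b|y|²} / (1 + |y|²)`. -/
def normX (n : ℕ) (b : ℝ) (u : En n → ℝ) : ℝ :=
  sSup (Set.range fun y : En n => |u y| * Real.exp (b * ‖y‖ ^ 2) / (1 + ‖y‖ ^ 2))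

/-- The positive anomalous exponent `α⁺(F)`. -/
def alphaPlus (n : ℕ) (lam Lam : ℝ) (F : Mat n → ℝ) : ℝ :=
  sSup { α : ℝ | ∃ φ : En n → ℝ, memX n (1/(8*Lam)) φ ∧ (∀ y, 0 ≤ φ y) ∧ φ ≠ 0 ∧
    ViscSupE n Set.univ (Fop n F α (fun _ => 0)) φ }

/-- `Φ` is a positive self-similar solution of `u_t + F(D²u) = 0` with exponent `α`,
with a Gaussian upper bound at time one. -/
def IsSelfSimilarPlus (n : ℕ) (F : Mat n → ℝ) (α : ℝ) (Φ : En n × ℝ → ℝ) : Prop :=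
  ContinuousOn Φ (Qset n) ∧
  (∀ p ∈ Qset n, 0 < Φ p) ∧
  ViscSolP n (Qset n) (fun M _ _ _ => F M) Φ ∧
  (∀ σ : ℝ, 0 < σ → ∀ x : En n, ∀ t : ℝ, 0 < t →
    Φ (x, t) = σ ^ α * Φ (Real.sqrt σ • x, σ * t)) ∧
  (∃ C : ℝ, 0 < C ∧ ∃ a : ℝ, 0 < a ∧ ∀ x : En n, Φ (x, 1) ≤ C * Real.exp (-a * ‖x‖ ^ 2))

/-- `Φ` is a negative self-similar solution of `u_t + F(D²u) = 0` with exponent `α`,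
with a Gaussian lower bound at time one. -/
def IsSelfSimilarMinus (n : ℕ) (F : Mat n → ℝ) (α : ℝ) (Φ : En n × ℝ → ℝ) : Prop :=
  ContinuousOn Φ (Qset n) ∧
  (∀ p ∈ Qset n, Φ p < 0) ∧
  ViscSolP n (Qset n) (fun M _ _ _ => F M) Φ ∧
  (∀ σ : ℝ, 0 < σ → ∀ x : En n, ∀ t : ℝ, 0 < t →
    Φ (x, t) = σ ^ α * Φ (Real.sqrt σ • x, σ * t)) ∧
  (∃ C : ℝ, 0 < C ∧ ∃ a : ℝ, 0 < a ∧ ∀ x : En n, -Φ (x, 1) ≤ C * Real.exp (-a * ‖x‖ ^ 2))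

/-- The set `S` of locally uniform sequential limits of the rescalings
`u^σ(x,t) = σ^α u(σ^{1/2} x, σ t)` as `σ → ∞`. -/
def limitSet (n : ℕ) (α : ℝ) (u : En n × ℝ → ℝ) : Set (En n × ℝ → ℝ) :=
  { U | ContinuousOn U (Qset n) ∧ ∃ σ : ℕ → ℝ,
      Tendsto σ atTop atTop ∧
      TendstoLocallyUniformlyOn
        (fun k (p : En n × ℝ) => (σ k) ^ α * u (Real.sqrt (σ k) • p.1, σ k * p.2))
        U atTop (Qset n) }

open MeasureTheory Metric

section ConvexAnalysis

variable {E : Type*} [NormedAddCommGroup E] [InnerProductSpace ℝ E]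

/-- `p` is a subgradient of `g` at `x`. -/
def IsSubgrad (g : E → ℝ) (x p : E) : Prop := ∀ y, g x + inner ℝ p (y - x) ≤ g y

lemma IsSubgrad.inner_sub_nonneg {g : E → ℝ} {x y p q : E} (hp : IsSubgrad g x p)
    (hq : IsSubgrad g y q) : 0 ≤ inner ℝ (p - q) (x - y) := by
  have h1 := hp y
  have h2 := hq x
  have h3 : inner ℝ p (y - x) = - inner ℝ p (x - y) := by rw [← inner_neg_right, neg_sub]
  rw [inner_sub_left]
  linarith

lemma convexOn_of_isSubgrad {g : E → ℝ} {P : E → E} (h : ∀ x, IsSubgrad g x (P x)) :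
    ConvexOn ℝ univ g := by
  refine ⟨convex_univ, fun x _ y _ a b ha hb hab => ?_⟩
  set m := a • x + b • y
  have h1 := mul_le_mul_of_nonneg_left (h m x) ha
  have h2 := mul_le_mul_of_nonneg_left (h m y) hb
  have h3 : a * inner ℝ (P m) (x - m) + b * inner ℝ (P m) (y - m) = 0 := by
    rw [← inner_smul_right, ← inner_smul_right, ← inner_add_right]
    have : a • (x - m) + b • (y - m) = 0 := by
      rw [smul_sub, smul_sub, sub_add_sub_comm, ← add_smul, hab, one_smul, sub_self]
    rw [this, inner_zero_right]
  simp only [smul_eq_mul]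
  have h4 : g m = a * g m + b * g m := by rw [← add_mul, hab, one_mul]
  linarith

lemma continuous_of_isSubgrad [FiniteDimensional ℝ E] {g : E → ℝ} {P : E → E}
    (h : ∀ x, IsSubgrad g x (P x)) : Continuous g := by
  have := (convexOn_of_isSubgrad h).continuousOn_interior
  rwa [interior_univ, continuousOn_univ] at this

lemma exists_resolvent [FiniteDimensional ℝ E] {g : E → ℝ} {P : E → E}
    (h : ∀ x, IsSubgrad g x (P x)) (z : E) : ∃ x, IsSubgrad g x (z - x) := by
  have hc := continuous_of_isSubgrad h
  obtain ⟨x, hx⟩ := Continuous.exists_forall_le' (f := fun x => g x + ‖x - z‖ ^ 2 / 2)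
    (by fun_prop) z (by
      have : (closedBall z (2 * ‖P z‖))ᶜ ∈ cocompact E :=
        (isCompact_closedBall z _).compl_mem_cocompact
      filter_upwards [this] with x hx
      have hx : 2 * ‖P z‖ < ‖x - z‖ := by simpa [dist_eq_norm] using hx
      have h1 := h z x
      have h2 := abs_le.1 (abs_real_inner_le_norm (P z) (x - z))
      have h3 : ‖z - z‖ = 0 := by simp
      rw [h3]
      nlinarith [norm_nonneg (x - z), norm_nonneg (P z)])
  refine ⟨x, fun y => ?_⟩
  have key : ∀ t : ℝ, 0 < t → t ≤ 1 →
      g x + inner ℝ (z - x) (y - x) ≤ g y + t * (‖y - x‖ ^ 2 / 2) := by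
    intro t ht ht1
    have h1 := hx (x + t • (y - x))
    have h2 := (convexOn_of_isSubgrad h).2 (mem_univ x) (mem_univ y) (sub_nonneg.2 ht1) ht.le
      (by ring)
    have h3 : (1 - t) • x + t • y = x + t • (y - x) := by
      rw [sub_smul, smul_sub, one_smul]; abel
    rw [h3] at h2
    have h4 : ‖x + t • (y - x) - z‖ ^ 2 =
        ‖x - z‖ ^ 2 - 2 * t * inner ℝ (z - x) (y - x) + t ^ 2 * ‖y - x‖ ^ 2 := by
      have : x + t • (y - x) - z = (x - z) + t • (y - x) := by abel
      rw [this, norm_add_sq_real, inner_smul_right, norm_smul, mul_pow, Real.norm_eq_abs, sq_abs,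
        ← neg_sub z x, inner_neg_left]
      ring
    simp only [smul_eq_mul] at h2
    have h5 : t * (g x + inner ℝ (z - x) (y - x)) ≤ t * (g y + t * (‖y - x‖ ^ 2 / 2)) := by
      nlinarith
    exact le_of_mul_le_mul_left h5 ht
  have hlim : Tendsto (fun t : ℝ => g y + t * (‖y - x‖ ^ 2 / 2)) (𝓝[>] 0) (𝓝 (g y)) := by
    have : ContinuousAt (fun t : ℝ => g y + t * (‖y - x‖ ^ 2 / 2)) 0 := by fun_prop
    have h := this.tendsto.mono_left (nhdsWithin_le_nhds (s := Ioi 0))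
    simpa using h
  refine ge_of_tendsto hlim ?_
  filter_upwards [Ioc_mem_nhdsGT (zero_lt_one' ℝ)] with t ht
  exact key t ht.1 ht.2

lemma norm_sq_le_inner_of_isSubgrad {g : E → ℝ} {x y z w : E} (hx : IsSubgrad g x (z - x))
    (hy : IsSubgrad g y (w - y)) : ‖x - y‖ ^ 2 ≤ inner ℝ (z - w) (x - y) := by
  have h := hx.inner_sub_nonneg hy
  have : z - x - (w - y) = (z - w) - (x - y) := by abel
  rw [this, inner_sub_left, real_inner_self_eq_norm_sq] at h
  linarith

lemma norm_sub_le_of_isSubgrad {g : E → ℝ} {x y z w : E} (hx : IsSubgrad g x (z - x))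
    (hy : IsSubgrad g y (w - y)) : ‖x - y‖ ≤ ‖z - w‖ := by
  have h := norm_sq_le_inner_of_isSubgrad hx hy
  have h2 := real_inner_le_norm (z - w) (x - y)
  by_contra! hlt
  nlinarith [norm_nonneg (z - w), norm_nonneg (x - y)]

end ConvexAnalysis

section Alexandrov

variable {E : Type*} [NormedAddCommGroup E] [InnerProductSpace ℝ E]

lemma continuousAt_add_of_hasFDerivAt_resolvent {g : E → ℝ} {P R : E → E}
    (hP : ∀ x, IsSubgrad g x (P x)) (hR : ∀ z, IsSubgrad g (R z) (z - R z)) {x : E}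
    {T : E ≃L[ℝ] E} (hT : HasFDerivAt R (T : E →L[ℝ] E) (x + P x)) :
    ContinuousAt (fun y => y + P y) x := by
  have hRP : ∀ y, R (y + P y) = y := by
    intro y
    have h1 : IsSubgrad g y (y + P y - y) := by simpa using hP y
    have := norm_sub_le_of_isSubgrad (hR (y + P y)) h1
    rw [sub_self, norm_zero] at this
    exact sub_eq_zero.1 (norm_le_zero_iff.1 this)
  set z := x + P x with hz
  have hRz : R z = x := hRP x
  obtain ⟨c, hc, hcT⟩ : ∃ c > 0, ∀ h, 2 * c * ‖h‖ ≤ ‖T h‖ := by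
    refine ⟨(‖(T.symm : E →L[ℝ] E)‖ + 1)⁻¹ / 2, by positivity, fun h => ?_⟩
    have h1 := (T.symm : E →L[ℝ] E).le_opNorm (T h)
    simp only [ContinuousLinearEquiv.coe_coe, ContinuousLinearEquiv.symm_apply_apply] at h1
    have hpos : 0 < ‖(T.symm : E →L[ℝ] E)‖ + 1 := by positivity
    rw [mul_div_cancel₀ _ two_ne_zero, inv_mul_le_iff₀ hpos]
    nlinarith [norm_nonneg (T h)]
  obtain ⟨δ₀, hδ₀, hδ⟩ : ∃ δ₀ > 0, ∀ w, ‖w - z‖ < δ₀ → c * ‖w - z‖ ≤ ‖R w - x‖ := by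
    have h1 := hT.isLittleO.def hc
    obtain ⟨δ₀, hδ₀, h2⟩ := Metric.eventually_nhds_iff.1 h1
    refine ⟨δ₀, hδ₀, fun w hw => ?_⟩
    have h3 := h2 (y := w) (by rwa [dist_eq_norm])
    rw [hRz] at h3
    have h4 := hcT (w - z)
    have h5 : ‖T (w - z)‖ ≤ ‖R w - x‖ + ‖R w - x - (T : E →L[ℝ] E) (w - z)‖ := by
      have : T (w - z) = (R w - x) - (R w - x - (T : E →L[ℝ] E) (w - z)) := by simp
      nth_rewrite 1 [this]
      exact norm_sub_le _ _
    linarith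
  rw [Metric.continuousAt_iff]
  intro ε hε
  set δ := min ε δ₀ / 2 with hδdef
  have hmin : 0 < min ε δ₀ := lt_min hε hδ₀
  have hδpos : 0 < δ := by positivity
  have hδε : δ < ε := by have := min_le_left ε δ₀; linarith
  have hδδ : δ < δ₀ := by have := min_le_right ε δ₀; linarith
  refine ⟨c ^ 2 * δ, by positivity, fun {y} hy => ?_⟩
  rw [dist_eq_norm] at hy ⊢
  by_contra! hcon
  set w := y + P y with hw
  have hwz : δ ≤ ‖w - z‖ := hδε.le.trans hcon
  have hwpos : 0 < ‖w - z‖ := hδpos.trans_le hwz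
  set s := δ / ‖w - z‖ with hs
  have hs0 : 0 < s := by positivity
  have hs1 : s ≤ 1 := (div_le_one hwpos).2 hwz
  have hsw : s * ‖w - z‖ = δ := div_mul_cancel₀ _ hwpos.ne'
  set q := z + s • (w - z) with hq
  have hqz : q - z = s • (w - z) := by simp [hq]
  have hqn : ‖q - z‖ = δ := by rw [hqz, norm_smul, Real.norm_eq_abs, abs_of_pos hs0, hsw]
  have h1 : 0 ≤ inner ℝ (w - z) (y - R q) := by
    rcases hs1.eq_or_lt with h | h
    · have : q = w := by rw [hq, h, one_smul]; abel
      rw [this, hw, hRP, sub_self, inner_zero_right]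
    · have h2 := norm_sq_le_inner_of_isSubgrad (hR w) (hR q)
      have h3 : w - q = (1 - s) • (w - z) := by
        rw [hq, sub_smul, one_smul]; abel
      rw [h3, inner_smul_left, hw, hRP] at h2
      have h4 : 0 ≤ (1 - s) * inner ℝ (w - z) (y - R q) :=
        (sq_nonneg _).trans (by simpa using h2)
      exact nonneg_of_mul_nonneg_right h4 (sub_pos.2 h)
  have h2 : c ^ 2 * δ ^ 2 ≤ s * inner ℝ (w - z) (R q - x) := by
    have h3 := norm_sq_le_inner_of_isSubgrad (hR q) (hR z)
    rw [hRz, hqz, inner_smul_left] at h3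
    have h4 := hδ q (by rw [hqn]; exact hδδ)
    rw [hqn] at h4
    calc c ^ 2 * δ ^ 2 = (c * δ) ^ 2 := by ring
      _ ≤ ‖R q - x‖ ^ 2 := by gcongr
      _ ≤ _ := by simpa using h3
  have h3 : c ^ 2 * δ ^ 2 ≤ s * inner ℝ (w - z) (y - x) := by
    have : y - x = (y - R q) + (R q - x) := by abel
    rw [this, inner_add_right, mul_add]
    have := mul_nonneg hs0.le h1
    linarith
  have h4 : s * inner ℝ (w - z) (y - x) ≤ δ * ‖y - x‖ := by
    rw [← hsw, mul_assoc]
    exact mul_le_mul_of_nonneg_left (real_inner_le_norm _ _) hs0.le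
  nlinarith

lemma abs_sub_le_of_forall_abs_sub_le {m : ℝ → ℝ} {K L : ℝ}
    (h : ∀ s t, 0 ≤ s → s ≤ t → t ≤ 1 → |m t - m s| ≤ K * (t - s) ^ 2 + L * (t - s)) :
    |m 1 - m 0| ≤ L := by
  have key : ∀ N : ℕ, 0 < N → |m 1 - m 0| ≤ K * (1 / (N : ℝ)) + L := by
    intro N hN
    have hN' : (0 : ℝ) < N := by exact_mod_cast hN
    have step : ∀ j : ℕ, j ≤ N →
        |m (j / N) - m 0| ≤ j * (K * (1 / (N : ℝ)) ^ 2 + L * (1 / N)) := by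
      intro j
      induction j with
      | zero => intro _; simp
      | succ j ih =>
        intro hj
        have h1 := ih (by omega)
        have h2 := h (j / N) ((j + 1 : ℕ) / N) (by positivity) (by gcongr; omega)
          (by rw [div_le_one hN']; exact_mod_cast hj)
        have h3 : ((j + 1 : ℕ) : ℝ) / N - j / N = 1 / N := by push_cast; field_simp; ring
        rw [h3] at h2
        have h4 := abs_sub_le (m ((j + 1 : ℕ) / N)) (m (j / N)) (m 0)
        push_cast at *
        linarith
    have h1 := step N le_rfl
    rw [div_self hN'.ne'] at h1
    refine h1.trans (le_of_eq ?_)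
    field_simp
  have hlim : Tendsto (fun N : ℕ => K * (1 / (N : ℝ)) + L) atTop (𝓝 L) := by
    simpa using ((tendsto_one_div_atTop_nhds_zero_nat (𝕜 := ℝ)).const_mul K).add_const L
  refine ge_of_tendsto hlim ?_
  filter_upwards [eventually_gt_atTop 0] with N hN
  exact key N hN

lemma second_order_expansion_of_isSubgrad {g : E → ℝ} {P : E → E}
    (hP : ∀ x, IsSubgrad g x (P x)) {x : E} {B : E →L[ℝ] E} (hB : HasFDerivAt P B x) {η : ℝ}
    (hη : 0 < η) :
    ∀ᶠ y in 𝓝 x, |g y - g x - inner ℝ (P x) (y - x) - inner ℝ (B (y - x)) (y - x) / 2|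
      ≤ η * ‖y - x‖ ^ 2 := by
  obtain ⟨δ, hδ, h2⟩ := Metric.eventually_nhds_iff.1 (hB.isLittleO.def hη)
  refine Metric.eventually_nhds_iff.2 ⟨δ, hδ, fun {y} hy => ?_⟩
  set h := y - x with hh
  have hnh : ‖h‖ < δ := by rwa [dist_eq_norm] at hy
  have herr : ∀ s : ℝ, 0 ≤ s → s ≤ 1 →
      |inner ℝ (P (x + s • h)) h - inner ℝ (P x) h - s * inner ℝ (B h) h| ≤ η * ‖h‖ ^ 2 := by
    intro s hs hs1
    have hsn : ‖s • h‖ ≤ ‖h‖ := by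
      rw [norm_smul, Real.norm_eq_abs, abs_of_nonneg hs]
      exact mul_le_of_le_one_left (norm_nonneg _) hs1
    have h3 := h2 (y := x + s • h) (by rw [dist_eq_norm, add_sub_cancel_left]; linarith)
    rw [add_sub_cancel_left] at h3
    have h4 : inner ℝ (P (x + s • h)) h - inner ℝ (P x) h - s * inner ℝ (B h) h
        = inner ℝ (P (x + s • h) - P x - B (s • h)) h := by
      rw [inner_sub_left, inner_sub_left, map_smul, inner_smul_left]; simp
    rw [h4]
    calc _ ≤ ‖P (x + s • h) - P x - B (s • h)‖ * ‖h‖ := abs_real_inner_le_norm _ _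
      _ ≤ (η * ‖s • h‖) * ‖h‖ := by gcongr
      _ ≤ (η * ‖h‖) * ‖h‖ := by gcongr
      _ = _ := by ring
  set β := inner ℝ (B h) h with hβ
  have main := abs_sub_le_of_forall_abs_sub_le (K := |β|) (L := η * ‖h‖ ^ 2)
    (m := fun s => g (x + s • h) - s * inner ℝ (P x) h - s ^ 2 / 2 * β) (by
      intro s t hs hst ht
      have e1 := abs_le.1 (herr s hs (hst.trans ht))
      have e2 := abs_le.1 (herr t (hs.trans hst) ht)
      have g1 := hP (x + s • h) (x + t • h)
      have g2 := hP (x + t • h) (x + s • h)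
      have d1 : x + t • h - (x + s • h) = (t - s) • h := by rw [sub_smul]; abel
      have d2 : x + s • h - (x + t • h) = (s - t) • h := by rw [sub_smul]; abel
      rw [d1, inner_smul_right] at g1
      rw [d2, inner_smul_right] at g2
      have hts : 0 ≤ t - s := sub_nonneg.2 hst
      have b1 := mul_nonneg (sq_nonneg (t - s)) (by linarith [neg_abs_le β] : 0 ≤ |β| + β)
      have b2 := mul_nonneg (sq_nonneg (t - s)) (by linarith [le_abs_self β] : 0 ≤ |β| - β)
      have b3 := mul_nonneg (sq_nonneg (t - s)) (abs_nonneg β)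
      rw [abs_le]
      constructor
      · nlinarith [mul_le_mul_of_nonneg_left e1.1 hts]
      · nlinarith [mul_le_mul_of_nonneg_left e2.2 hts])
  have hxy : x + h = y := by simp [hh]
  simp only [one_smul, zero_smul, add_zero, hxy] at main
  convert main using 2
  ring

/-- **Alexandrov's theorem**, in terms of a selection `P` of subgradients. -/
theorem alexandrov_convex [FiniteDimensional ℝ E] [MeasurableSpace E] [BorelSpace E]
    (μ : Measure E) [μ.IsAddHaarMeasure] {g : E → ℝ} {P : E → E}
    (hP : ∀ x, IsSubgrad g x (P x)) : ∀ᵐ x ∂μ, ∃ B : E →L[ℝ] E, HasFDerivAt P B x := by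
  choose R hR using exists_resolvent hP
  have hRP : ∀ y, R (y + P y) = y := by
    intro y
    have h1 : IsSubgrad g y (y + P y - y) := by simpa using hP y
    have := norm_sub_le_of_isSubgrad (hR (y + P y)) h1
    rw [sub_self, norm_zero] at this
    exact sub_eq_zero.1 (norm_le_zero_iff.1 this)
  have hlip : LipschitzWith 1 R := LipschitzWith.of_dist_le_mul fun z w => by
    rw [dist_eq_norm, dist_eq_norm, NNReal.coe_one, one_mul]
    exact norm_sub_le_of_isSubgrad (hR z) (hR w)
  have hdiff : ∀ᵐ z ∂(μH[Module.finrank ℝ E] : Measure E), DifferentiableAt ℝ R z :=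
    hlip.ae_differentiableAt
  have hac : μ ≪ (μH[Module.finrank ℝ E] : Measure E) := Measure.absolutelyContinuous_isAddHaarMeasure _ _
  have n1 : μ (R '' {z | ¬ DifferentiableAt ℝ R z}) = 0 := by
    refine hac ?_
    have := hlip.hausdorffMeasure_image_le (Nat.cast_nonneg (Module.finrank ℝ E))
      {z | ¬ DifferentiableAt ℝ R z}
    rw [ae_iff.1 hdiff] at this
    simpa using this
  have n2 : μ (R '' {z | DifferentiableAt ℝ R z ∧ (fderiv ℝ R z).det = 0}) = 0 :=
    addHaar_image_eq_zero_of_det_fderivWithin_eq_zero μ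
      (fun z hz => hz.1.hasFDerivAt.hasFDerivWithinAt) (fun z hz => hz.2)
  filter_upwards [measure_eq_zero_iff_ae_notMem.1 n1, measure_eq_zero_iff_ae_notMem.1 n2]
    with x hx1 hx2
  have hd : DifferentiableAt ℝ R (x + P x) := by
    by_contra hcon
    exact hx1 ⟨_, hcon, hRP x⟩
  have hdet : (fderiv ℝ R (x + P x)).det ≠ 0 := fun hcon => hx2 ⟨_, ⟨hd, hcon⟩, hRP x⟩
  set T := (fderiv ℝ R (x + P x)).toContinuousLinearEquivOfDetNeZero hdet with hTdef
  have hT : HasFDerivAt R (T : E →L[ℝ] E) (x + P x) := by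
    rw [hTdef, ContinuousLinearMap.coe_toContinuousLinearEquivOfDetNeZero]
    exact hd.hasFDerivAt
  have hcont := continuousAt_add_of_hasFDerivAt_resolvent hP hR hT
  have h1 := HasFDerivAt.of_local_left_inverse hcont hT (Eventually.of_forall hRP)
  refine ⟨_, (h1.sub (hasFDerivAt_id x)).congr_of_eventuallyEq ?_⟩
  exact Eventually.of_forall fun y => by simp

/-- `f` is semiconvex with constant `κ`, as witnessed by the selection `p` of slopes of
paraboloids touching it from below. -/
def IsSemiconvex (κ : ℝ) (f : E → ℝ) (p : E → E) : Prop :=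
  ∀ x y, f x + inner ℝ (p x) (y - x) - κ / 2 * ‖y - x‖ ^ 2 ≤ f y

lemma norm_sq_eq_add (x y : E) :
    ‖y‖ ^ 2 = ‖x‖ ^ 2 + 2 * inner ℝ x (y - x) + ‖y - x‖ ^ 2 := by
  rw [← norm_add_sq_real, add_sub_cancel]

lemma IsSemiconvex.isSubgrad {κ : ℝ} {f : E → ℝ} {p : E → E} (h : IsSemiconvex κ f p) (x : E) :
    IsSubgrad (fun x => f x + κ / 2 * ‖x‖ ^ 2) x (p x + κ • x) := by
  intro y
  have h1 := h x y
  have h2 := norm_sq_eq_add x y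
  simp only [inner_add_left, inner_smul_left]
  rw [h2]
  simp only [conj_trivial]
  linarith

lemma IsSemiconvex.continuous [FiniteDimensional ℝ E] {κ : ℝ} {f : E → ℝ} {p : E → E}
    (h : IsSemiconvex κ f p) : Continuous f := by
  have h1 : Continuous fun x => f x + κ / 2 * ‖x‖ ^ 2 := continuous_of_isSubgrad h.isSubgrad
  have h2 : Continuous fun x : E => κ / 2 * ‖x‖ ^ 2 := by fun_prop
  exact (h1.sub h2).congr fun x => by simp

/-- `f` has the second order expansion with slope `p` and Hessian `B` at `x`. -/
def HasExpansionAt (f : E → ℝ) (p : E) (B : E →L[ℝ] E) (x : E) : Prop :=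
  ∀ η > 0, ∀ᶠ y in 𝓝 x, |f y - f x - inner ℝ p (y - x) - inner ℝ (B (y - x)) (y - x) / 2|
      ≤ η * ‖y - x‖ ^ 2

theorem IsSemiconvex.ae_hasExpansionAt [FiniteDimensional ℝ E] [MeasurableSpace E] [BorelSpace E]
    (μ : Measure E) [μ.IsAddHaarMeasure] {κ : ℝ} {f : E → ℝ} {p : E → E}
    (h : IsSemiconvex κ f p) : ∀ᵐ x ∂μ, ∃ B : E →L[ℝ] E, HasExpansionAt f (p x) B x := by
  filter_upwards [alexandrov_convex μ h.isSubgrad] with x ⟨B, hB⟩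
  refine ⟨B - κ • ContinuousLinearMap.id ℝ E, fun η hη => ?_⟩
  filter_upwards [second_order_expansion_of_isSubgrad h.isSubgrad hB hη] with y hy
  convert hy using 2
  have h2 := norm_sq_eq_add x y
  rw [h2]
  have h3 : inner ℝ ((B - κ • ContinuousLinearMap.id ℝ E) (y - x)) (y - x)
      = inner ℝ (B (y - x)) (y - x) - κ * ‖y - x‖ ^ 2 := by
    rw [← real_inner_self_eq_norm_sq, _root_.sub_apply, inner_sub_left]
    simp [inner_smul_left]
  rw [h3]
  simp only [inner_add_left, inner_smul_left, conj_trivial]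
  ring

end Alexandrov

section Jensen

variable {E : Type*} [NormedAddCommGroup E] [InnerProductSpace ℝ E]

/-- The quadratic polynomial with value `0`, gradient `b` and Hessian `S` at `x₀`. -/
def quadPoly (b : E) (S : E →L[ℝ] E) (x₀ : E) (x : E) : ℝ :=
  inner ℝ b (x - x₀) + inner ℝ (S (x - x₀)) (x - x₀) / 2

lemma quadPoly_sub {b : E} {S : E →L[ℝ] E} (hS : ∀ x y, inner ℝ (S x) y = inner ℝ (S y) x)
    (x₀ x y : E) : quadPoly b S x₀ y - quadPoly b S x₀ x =
      inner ℝ (b + S (x - x₀)) (y - x) + inner ℝ (S (y - x)) (y - x) / 2 := by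
  have h : y - x₀ = (x - x₀) + (y - x) := by abel
  simp only [quadPoly]
  rw [h]
  simp only [map_add, inner_add_left, inner_add_right]
  rw [hS (y - x) (x - x₀)]
  ring

lemma IsSemiconvex.add_sub_quadPoly {κ κ' : ℝ} {f g : E → ℝ} {p q : E → E}
    (hf : IsSemiconvex κ f p) (hg : IsSemiconvex κ' g q) {b : E} {S : E →L[ℝ] E}
    (hS : ∀ x y, inner ℝ (S x) y = inner ℝ (S y) x) (x₀ : E) :
    IsSemiconvex (κ + κ' + ‖S‖) (fun x => f x + g x - quadPoly b S x₀ x)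
      (fun x => p x + q x - (b + S (x - x₀))) := by
  intro x y
  have h1 := hf x y
  have h2 := hg x y
  have h3 := quadPoly_sub (b := b) hS x₀ x y
  have h4 : inner ℝ (S (y - x)) (y - x) ≤ ‖S‖ * ‖y - x‖ ^ 2 := by
    calc _ ≤ ‖S (y - x)‖ * ‖y - x‖ := real_inner_le_norm _ _
      _ ≤ (‖S‖ * ‖y - x‖) * ‖y - x‖ := by gcongr; exact S.le_opNorm _
      _ = _ := by ring
  rw [inner_sub_left, inner_add_left]
  linarith

lemma eq_zero_of_forall_inner_le {v : E} {c δ : ℝ} (hδ : 0 < δ)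
    (h : ∀ w : E, ‖w‖ < δ → inner ℝ v w ≤ c * ‖w‖ ^ 2) : v = 0 := by
  by_contra hv
  have hpos : 0 < ‖v‖ := norm_pos_iff.2 hv
  have key : ∀ᶠ t in 𝓝[>] (0 : ℝ), 1 ≤ c * t := by
    have h1 : ∀ᶠ t in 𝓝[>] (0 : ℝ), t * ‖v‖ < δ := by
      have : Tendsto (fun t : ℝ => t * ‖v‖) (𝓝[>] 0) (𝓝 (0 * ‖v‖)) :=
        (tendsto_id.mul_const _).mono_left nhdsWithin_le_nhds
      rw [zero_mul] at this
      exact this.eventually_lt_const hδ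
    filter_upwards [h1, self_mem_nhdsWithin] with t ht ht0
    have ht0 : 0 < t := ht0
    have hn : ‖t • v‖ = t * ‖v‖ := by rw [norm_smul, Real.norm_eq_abs, abs_of_pos ht0]
    have h2 := h (t • v) (by rwa [hn])
    rw [inner_smul_right, real_inner_self_eq_norm_sq, hn] at h2
    have h3 : 0 < t * ‖v‖ ^ 2 := by positivity
    by_contra! hc
    nlinarith
  have hlim : Tendsto (fun t : ℝ => c * t) (𝓝[>] 0) (𝓝 (c * 0)) :=
    (tendsto_id.const_mul _).mono_left nhdsWithin_le_nhds
  have := ge_of_tendsto hlim key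
  norm_num at this

/-- **Jensen's lemma**: a semiconvex function with a strict local maximum at `x₀` is touched from
above by planes of small slope at points near `x₀` outside any given null set. -/
theorem exists_contact_notMem [FiniteDimensional ℝ E] [MeasurableSpace E] [BorelSpace E]
    (μ : Measure E) [μ.IsAddHaarMeasure] {c : ℝ} (hc : 0 ≤ c) {W : E → ℝ} {p : E → E}
    (hW : IsSemiconvex c W p) {x₀ : E} {ρ r : ℝ} (hρ : 0 < ρ) (hr : 0 < r)
    (hgap : ∀ x, ρ ≤ ‖x - x₀‖ → ‖x - x₀‖ ≤ 4 * ρ → W x + 4 * ρ * r < W x₀)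
    {N : Set E} (hN : μ N = 0) :
    ∃ x, x ∉ N ∧ ‖x - x₀‖ < ρ ∧ ‖p x‖ ≤ r ∧ ∀ᶠ y in 𝓝 x, W y ≤ W x + inner ℝ (p x) (y - x) := by
  have hcont := hW.continuous
  set K : Set E := {x | ‖x - x₀‖ < ρ ∧
    ∀ y, ‖y - x₀‖ ≤ 4 * ρ → W y ≤ W x + inner ℝ (p x) (y - x)} with hK
  have hcover : closedBall (0 : E) r ⊆ p '' K := by
    intro e he
    have he : ‖e‖ ≤ r := by simpa using he
    obtain ⟨x, hxm, hx⟩ := (isCompact_closedBall x₀ (4 * ρ)).exists_isMaxOn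
      ⟨x₀, mem_closedBall_self (by positivity)⟩
      (f := fun x => W x - inner ℝ e (x - x₀)) (by fun_prop)
    rw [mem_closedBall, dist_eq_norm] at hxm
    have hx' : ∀ y, ‖y - x₀‖ ≤ 4 * ρ → W y ≤ W x + inner ℝ e (y - x) := by
      intro y hy
      have h1 : W y - inner ℝ e (y - x₀) ≤ W x - inner ℝ e (x - x₀) :=
        hx (by rwa [mem_closedBall, dist_eq_norm])
      have h2 : y - x = (y - x₀) - (x - x₀) := by abel
      rw [h2, inner_sub_right]
      linarith
    have hxρ : ‖x - x₀‖ < ρ := by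
      by_contra! hcon
      have h1 := hgap x hcon hxm
      have h2 := hx' x₀ (by simp; positivity)
      have h3 := real_inner_le_norm e (x₀ - x)
      rw [norm_sub_rev] at h3
      have h4 : ‖e‖ * ‖x - x₀‖ ≤ r * (4 * ρ) := by gcongr
      linarith
    have hpe : p x = e := by
      refine sub_eq_zero.1 (eq_zero_of_forall_inner_le (c := c / 2) hρ fun w hw => ?_)
      have h1 := hW x (x + w)
      have h2 := hx' (x + w) (by
        have : x + w - x₀ = (x - x₀) + w := by abel
        rw [this]
        refine (norm_add_le _ _).trans ?_
        linarith)
      rw [add_sub_cancel_left] at h1 h2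
      rw [inner_sub_left]
      linarith
    exact ⟨x, ⟨hxρ, by rwa [hpe]⟩, hpe⟩
  have hlip : LipschitzOnWith (2 * c).toNNReal p K := by
    refine LipschitzOnWith.of_dist_le_mul fun x hx y hy => ?_
    rw [dist_eq_norm, dist_eq_norm, Real.coe_toNNReal _ (by positivity)]
    rcases eq_or_ne x y with rfl | hxy
    · simp
    rcases eq_or_ne (p x) (p y) with hpq | hpq
    · rw [hpq]; simp; positivity
    have hd : 0 < ‖x - y‖ := norm_pos_iff.2 (sub_ne_zero.2 hxy)
    have hv : 0 < ‖p x - p y‖ := norm_pos_iff.2 (sub_ne_zero.2 hpq)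
    set d := ‖x - y‖
    set w : E := (d / ‖p x - p y‖) • (p x - p y) with hw
    have hwn : ‖w‖ = d := by
      rw [hw, norm_smul, Real.norm_eq_abs, abs_of_pos (by positivity), div_mul_cancel₀ _ hv.ne']
    have hdρ : d ≤ 2 * ρ := by
      have : x - y = (x - x₀) - (y - x₀) := by abel
      have h1 := norm_sub_le (x - x₀) (y - x₀)
      rw [← this] at h1
      have := hx.1; have := hy.1
      change ‖x - y‖ ≤ _
      linarith
    have h1 := hW x (y + w)
    have h2 := hy.2 (y + w) (by
      have : y + w - x₀ = (y - x₀) + w := by abel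
      rw [this]
      refine (norm_add_le _ _).trans ?_
      have := hy.1
      linarith)
    have h3 := hx.2 y (by have := hy.1; linarith)
    rw [add_sub_cancel_left] at h2
    have h4 : y + w - x = (y - x) + w := by abel
    have h5 : ‖y + w - x‖ ≤ 2 * d := by
      rw [h4]
      refine (norm_add_le _ _).trans ?_
      rw [norm_sub_rev, hwn]
      change d + d ≤ _
      linarith
    have h6 : inner ℝ (p x) (y + w - x) = inner ℝ (p x) (y - x) + inner ℝ (p x) w := by
      rw [h4, inner_add_right]
    have h7 : inner ℝ (p x) w - inner ℝ (p y) w = d * ‖p x - p y‖ := by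
      rw [← inner_sub_left, hw, inner_smul_right, real_inner_self_eq_norm_sq]
      field_simp
    have h8 : c / 2 * ‖y + w - x‖ ^ 2 ≤ c / 2 * (2 * d) ^ 2 := by gcongr
    have h9 : d * ‖p x - p y‖ ≤ d * (2 * c * d) := by nlinarith
    exact le_of_mul_le_mul_left h9 hd
  have hnull : μ (p '' (K ∩ N)) = 0 := by
    have hac : μ ≪ (μH[Module.finrank ℝ E] : Measure E) :=
      Measure.absolutelyContinuous_isAddHaarMeasure _ _
    have hac' : (μH[Module.finrank ℝ E] : Measure E) ≪ μ :=
      Measure.absolutelyContinuous_isAddHaarMeasure _ _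
    refine hac ?_
    have := (hlip.mono (inter_subset_left (t := N))).hausdorffMeasure_image_le
      (Nat.cast_nonneg (Module.finrank ℝ E))
    rw [measure_mono_null inter_subset_right (hac' hN), mul_zero] at this
    exact nonpos_iff_eq_zero.1 this
  by_contra! hcon
  have hsub : closedBall (0 : E) r ⊆ p '' (K ∩ N) := by
    intro e he
    obtain ⟨x, hx, rfl⟩ := hcover he
    refine ⟨x, ⟨hx, ?_⟩, rfl⟩
    by_contra hxN
    refine hcon x hxN hx.1 (by simpa using he) ?_
    have hopen : ∀ᶠ y in 𝓝 x, ‖y - x₀‖ < 4 * ρ :=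
      (by fun_prop : Continuous fun y => ‖y - x₀‖).continuousAt.eventually_lt_const
        (by have := hx.1; linarith)
    filter_upwards [hopen] with y hy
    exact not_lt.2 (hx.2 y hy.le)
  exact (measure_closedBall_pos μ (0 : E) hr).ne' (measure_mono_null hsub hnull)

end Jensen

section SupConvolution

variable {E : Type*} [NormedAddCommGroup E] [InnerProductSpace ℝ E]

/-- `f` is the sup-convolution of `u` with parameter `κ`, the supremum at `x` being attained at
`Y x`. -/
structure IsSupConvolution (κ : ℝ) (u f : E → ℝ) (Y : E → E) : Prop where
  le : ∀ x y, u y - κ / 2 * ‖y - x‖ ^ 2 ≤ f x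
  eq : ∀ x, f x = u (Y x) - κ / 2 * ‖Y x - x‖ ^ 2

lemma exists_isSupConvolution [FiniteDimensional ℝ E] {u : E → ℝ} (hu : Continuous u) {C : ℝ}
    (hC : ∀ x, u x ≤ C) {κ : ℝ} (hκ : 0 < κ) : ∃ f Y, IsSupConvolution κ u f Y := by
  have h : ∀ x, ∃ y, ∀ z, u z - κ / 2 * ‖z - x‖ ^ 2 ≤ u y - κ / 2 * ‖y - x‖ ^ 2 := by
    intro x
    refine Continuous.exists_forall_ge' (f := fun z => u z - κ / 2 * ‖z - x‖ ^ 2)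
      (by fun_prop) x ?_
    have : (closedBall x (1 + 2 * (C - u x) / κ))ᶜ ∈ cocompact E :=
      (isCompact_closedBall x _).compl_mem_cocompact
    filter_upwards [this] with z hz
    have hz : 1 + 2 * (C - u x) / κ < ‖z - x‖ := by simpa [dist_eq_norm] using hz
    have h0 : 0 ≤ 2 * (C - u x) / κ := by
      have := hC x
      exact div_nonneg (by linarith) hκ.le
    have h1 : 2 * (C - u x) / κ ≤ ‖z - x‖ ^ 2 := by nlinarith
    rw [div_le_iff₀ hκ] at h1
    have h2 := hC z
    simp only [sub_self, norm_zero]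
    nlinarith
  choose Y hY using h
  exact ⟨fun x => u (Y x) - κ / 2 * ‖Y x - x‖ ^ 2, Y, fun x y => hY x y, fun x => rfl⟩

lemma IsSupConvolution.isSemiconvex {κ : ℝ} {u f : E → ℝ} {Y : E → E}
    (h : IsSupConvolution κ u f Y) : IsSemiconvex κ f (fun x => κ • (Y x - x)) := by
  intro x y
  have h1 := h.le y (Y x)
  rw [h.eq x]
  have h2 : Y x - y = (Y x - x) - (y - x) := by abel
  rw [h2, norm_sub_sq_real] at h1
  simp only [inner_smul_left, conj_trivial]
  linarith

omit [InnerProductSpace ℝ E] in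
lemma IsSupConvolution.self_le {κ : ℝ} {u f : E → ℝ} {Y : E → E}
    (h : IsSupConvolution κ u f Y) (x : E) : u x ≤ f x := by
  simpa using h.le x x

/-- Translating the expansion of the sup-convolution to the point where the supremum is
attained. -/
lemma IsSupConvolution.eventually_le {κ : ℝ} {u f : E → ℝ} {Y : E → E}
    (h : IsSupConvolution κ u f Y) {x p : E} {B : E →L[ℝ] E} (hB : HasExpansionAt f p B x)
    {η : ℝ} (hη : 0 < η) :
    ∀ᶠ y in 𝓝 (Y x), u y ≤ u (Y x) + inner ℝ p (y - Y x)
      + inner ℝ (B (y - Y x)) (y - Y x) / 2 + η * ‖y - Y x‖ ^ 2 := by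
  have ht : Tendsto (fun y => y - Y x + x) (𝓝 (Y x)) (𝓝 x) := by
    have : ContinuousAt (fun y => y - Y x + x) (Y x) := by fun_prop
    simpa [ContinuousAt] using this
  filter_upwards [ht.eventually (hB η hη)] with y hy
  have h1 := h.le (y - Y x + x) y
  have h2 : y - (y - Y x + x) = Y x - x := by abel
  rw [h2] at h1
  have h3 := h.eq x
  rw [add_sub_cancel_right] at hy
  have h4 := (abs_le.1 hy).2
  linarith

lemma exists_forall_supConvolution_close [FiniteDimensional ℝ E] {u : E → ℝ} (hu : Continuous u)
    {C : ℝ} (hC : ∀ x, u x ≤ C) (x₀ : E) (r : ℝ) {ε : ℝ} (hε : 0 < ε) :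
    ∃ κ₀ > 0, ∀ κ ≥ κ₀, ∀ f Y, IsSupConvolution κ u f Y → ∀ x, ‖x - x₀‖ ≤ r →
      ‖Y x - x‖ < ε ∧ u (Y x) < u x + ε ∧ κ / 2 * ‖Y x - x‖ ^ 2 < ε ∧ f x < u x + ε := by
  have huc := (isCompact_closedBall x₀ (r + 1)).uniformContinuousOn_of_continuous hu.continuousOn
  obtain ⟨d, hd, hdu⟩ := Metric.uniformContinuousOn_iff.1 huc ε hε
  obtain ⟨m, hm⟩ := (isCompact_closedBall x₀ r).bddBelow_image hu.continuousOn
  set d' := min d (min ε 1) with hd'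
  have hd'pos : 0 < d' := by positivity
  refine ⟨2 * (|C - m| + 1) / d' ^ 2, by positivity, fun κ hκ f Y hf x hx => ?_⟩
  have hκpos : 0 < κ := lt_of_lt_of_le (by positivity) hκ
  have hmx : m ≤ u x := hm (mem_image_of_mem u (by rwa [mem_closedBall, dist_eq_norm]))
  have h1 := hf.le x x
  rw [hf.eq x] at h1
  have h1 : u x ≤ u (Y x) - κ / 2 * ‖Y x - x‖ ^ 2 := by simpa using h1
  have h2 : ‖Y x - x‖ < d' := by
    by_contra! hcon
    have h3 : d' ^ 2 ≤ ‖Y x - x‖ ^ 2 := by gcongr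
    have h4 : 2 * (|C - m| + 1) ≤ κ * d' ^ 2 := by
      rwa [ge_iff_le, div_le_iff₀ (by positivity)] at hκ
    have h5 := le_abs_self (C - m)
    have h6 := hC (Y x)
    nlinarith
  have hdd : d' ≤ d := min_le_left _ _
  have hde : d' ≤ ε := (min_le_right _ _).trans (min_le_left _ _)
  have hd1 : d' ≤ 1 := (min_le_right _ _).trans (min_le_right _ _)
  have h3 : u (Y x) < u x + ε := by
    have := hdu (Y x) (by
      rw [mem_closedBall, dist_eq_norm]
      have : Y x - x₀ = (Y x - x) + (x - x₀) := by abel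
      rw [this]
      refine (norm_add_le _ _).trans ?_
      linarith) x (by rw [mem_closedBall, dist_eq_norm]; linarith)
      (by rw [dist_eq_norm]; linarith)
    rw [Real.dist_eq] at this
    have := (abs_lt.1 this).2
    linarith
  have hnn : 0 ≤ κ / 2 * ‖Y x - x‖ ^ 2 := by positivity
  refine ⟨by linarith, h3, by linarith, ?_⟩
  rw [hf.eq x]
  linarith

end SupConvolution

section Hessian

variable {n : ℕ}

/-- The symmetric matrix of the quadratic form of `B` in the standard basis. -/
def symMat (B : En n →L[ℝ] En n) : Mat n :=
  Matrix.of fun i j => (inner ℝ (B (EuclideanSpace.single j 1)) (EuclideanSpace.single i 1)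
    + inner ℝ (B (EuclideanSpace.single i 1)) (EuclideanSpace.single j 1)) / 2

lemma symMat_isSymm (B : En n →L[ℝ] En n) : (symMat B).IsSymm := by
  ext i j
  simp only [symMat, Matrix.transpose_apply, Matrix.of_apply]
  ring

lemma symMat_add (B B' : En n →L[ℝ] En n) : symMat (B + B') = symMat B + symMat B' := by
  ext i j
  simp only [symMat, Matrix.add_apply, Matrix.of_apply, _root_.add_apply,
    inner_add_left]
  ring

lemma symMat_neg (B : En n →L[ℝ] En n) : symMat (-B) = -symMat B := by
  ext i j
  simp only [symMat, Matrix.neg_apply, Matrix.of_apply, _root_.neg_apply,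
    inner_neg_left]
  ring

lemma hasFDerivAt_quadPoly (b : En n) (B : En n →L[ℝ] En n) (y z : En n) :
    HasFDerivAt (quadPoly b B y) (innerSL ℝ b + (1 / 2 : ℝ) • (innerSL ℝ (B (z - y))
      + (innerSL ℝ (z - y)).comp B)) z := by
  have h1 : HasFDerivAt (fun x : En n => x - y) (ContinuousLinearMap.id ℝ (En n)) z :=
    (hasFDerivAt_id z).sub_const y
  have h2 : HasFDerivAt (fun x : En n => B (x - y)) (B.comp (ContinuousLinearMap.id ℝ (En n))) z :=
    B.hasFDerivAt.comp z h1
  have h3 := ((innerSL ℝ b).hasFDerivAt.comp z h1).add ((h2.inner ℝ h1).mul_const (1 / 2))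
  convert! h3 using 1
  · ext x
    simp [quadPoly]
    ring
  · ext h
    simp only [_root_.add_apply, _root_.smul_apply, innerSL_apply_apply,
      ContinuousLinearMap.comp_apply, ContinuousLinearMap.id_apply, smul_eq_mul,
      fderivInnerCLM_apply, ContinuousLinearMap.prod_apply]
    rw [real_inner_comm (B h) (z - y)]

lemma contDiff_quadPoly (b : En n) (B : En n →L[ℝ] En n) (y : En n) :
    ContDiff ℝ 2 (quadPoly b B y) := by
  have h : ContDiff ℝ 2 fun x : En n => x - y := contDiff_id.sub contDiff_const
  exact (contDiff_const.inner ℝ h).add (((B.contDiff.comp h).inner ℝ h).div_const 2)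

lemma fderiv_quadPoly_self (b : En n) (B : En n →L[ℝ] En n) (y : En n) :
    fderiv ℝ (quadPoly b B y) y = innerSL ℝ b := by
  rw [(hasFDerivAt_quadPoly b B y y).fderiv]
  ext h
  simp

lemma hess_quadPoly (b : En n) (B : En n →L[ℝ] En n) (y z : En n) :
    hess n (quadPoly b B y) z = symMat B := by
  ext i j
  simp only [hess, symMat, Matrix.of_apply, (hasFDerivAt_quadPoly b B y _).fderiv]
  have h : (fun x : En n => (innerSL ℝ b + (1 / 2 : ℝ) • (innerSL ℝ (B (x - y))
      + (innerSL ℝ (x - y)).comp B)) (EuclideanSpace.single j 1))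
      = quadPoly ((1 / 2 : ℝ) • (B.adjoint (EuclideanSpace.single j 1)
        + B (EuclideanSpace.single j 1))) 0 y + fun _ => inner ℝ b (EuclideanSpace.single j 1) := by
    ext x
    simp only [quadPoly, Pi.add_apply, _root_.add_apply,
      _root_.smul_apply, innerSL_apply_apply, ContinuousLinearMap.comp_apply,
      inner_smul_left, inner_add_left, ContinuousLinearMap.adjoint_inner_left,
      _root_.zero_apply, inner_zero_left, smul_eq_mul, conj_trivial]
    rw [real_inner_comm (EuclideanSpace.single j 1) (B (x - y)),
      real_inner_comm (B (EuclideanSpace.single j 1)) (x - y)]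
    ring
  rw [h, ((hasFDerivAt_quadPoly _ 0 y z).add (hasFDerivAt_const _ z)).fderiv]
  simp only [_root_.add_apply, _root_.smul_apply, innerSL_apply_apply,
    ContinuousLinearMap.comp_apply, inner_smul_left, inner_add_left,
    ContinuousLinearMap.adjoint_inner_left, _root_.zero_apply, inner_zero_left,
    inner_zero_right, smul_eq_mul, conj_trivial]
  rw [real_inner_comm (B (EuclideanSpace.single i 1)) (EuclideanSpace.single j 1)]
  ring

end Hessian

section Pucci

variable {n : ℕ} {lam Lam : ℝ}

lemma inner_eq_sum_single (B : En n →L[ℝ] En n) (x : En n) :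
    inner ℝ (B x) x = ∑ i, ∑ j, x i * x j *
      inner ℝ (B (EuclideanSpace.single i 1)) (EuclideanSpace.single j 1) := by
  have h : x = ∑ i, x i • EuclideanSpace.single i (1 : ℝ) := by
    simpa using ((EuclideanSpace.basisFun (Fin n) ℝ).sum_repr x).symm
  conv_lhs => rw [h]
  simp only [map_sum, map_smul, sum_inner, inner_sum, inner_smul_left, inner_smul_right,
    conj_trivial]
  rw [Finset.sum_comm (s := Finset.univ)]
  refine Finset.sum_congr rfl fun i _ => ?_
  rw [Finset.mul_sum]
  refine Finset.sum_congr rfl fun j _ => ?_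
  ring

lemma trace_mul_symMat {A : Mat n} (hA : A.IsHermitian) (B : En n →L[ℝ] En n) :
    (A * symMat B).trace = ∑ k, hA.eigenvalues k *
      inner ℝ (B (hA.eigenvectorBasis k)) (hA.eigenvectorBasis k) := by
  have hentry : ∀ i j, A i j = ∑ k, hA.eigenvalues k *
      (hA.eigenvectorBasis k i * hA.eigenvectorBasis k j) := by
    intro i j
    conv_lhs => rw [hA.spectral_theorem, Unitary.conjStarAlgAut_apply]
    simp only [Matrix.mul_apply, Matrix.diagonal_apply, Matrix.star_apply,
      IsHermitian.eigenvectorUnitary_apply, Function.comp, mul_ite, mul_zero, Finset.sum_ite_eq',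
      Finset.mem_univ, if_true, star_trivial, RCLike.ofReal_real_eq_id, id]
    refine Finset.sum_congr rfl fun k _ => ?_
    ring
  have hsum : ∀ k, inner ℝ (B (hA.eigenvectorBasis k)) (hA.eigenvectorBasis k) =
      ∑ i, ∑ j, hA.eigenvectorBasis k i * hA.eigenvectorBasis k j * symMat B j i := by
    intro k
    have h1 := inner_eq_sum_single B (hA.eigenvectorBasis k)
    have h2 := h1
    rw [Finset.sum_comm] at h2
    have h3 : inner ℝ (B (hA.eigenvectorBasis k)) (hA.eigenvectorBasis k) =
      (inner ℝ (B (hA.eigenvectorBasis k)) (hA.eigenvectorBasis k)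
        + inner ℝ (B (hA.eigenvectorBasis k)) (hA.eigenvectorBasis k)) / 2 := by ring
    rw [h3]
    nth_rewrite 1 [h1]
    rw [h2, ← Finset.sum_add_distrib, Finset.sum_div]
    refine Finset.sum_congr rfl fun i _ => ?_
    rw [← Finset.sum_add_distrib, Finset.sum_div]
    refine Finset.sum_congr rfl fun j _ => ?_
    simp only [symMat, Matrix.of_apply]
    ring
  simp only [Matrix.trace, Matrix.diag_apply, Matrix.mul_apply, hentry, hsum, Finset.sum_mul,
    Finset.mul_sum]
  conv_rhs => rw [Finset.sum_comm]
  refine Finset.sum_congr rfl fun i _ => ?_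
  rw [Finset.sum_comm]
  refine Finset.sum_congr rfl fun k _ => Finset.sum_congr rfl fun j _ => ?_
  ring

lemma pucciMatrices_nonempty (hLam : lam ≤ Lam) : (PucciMatrices n lam Lam).Nonempty := by
  have hH : (lam • (1 : Mat n)).IsHermitian := by
    simp [Matrix.IsHermitian]
  refine ⟨lam • 1, hH, fun i => ?_⟩
  have h : hH.eigenvalues i = lam := by
    have h1 := hH.eigenvalues_eq i
    have h2 := hH.eigenvectorBasis.orthonormal.1 i
    have h3 : inner ℝ (hH.eigenvectorBasis i) (hH.eigenvectorBasis i) = 1 := by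
      rw [real_inner_self_eq_norm_sq, h2]; norm_num
    rw [EuclideanSpace.inner_eq_star_dotProduct] at h3
    rw [h1, Matrix.smul_mulVec, Matrix.one_mulVec, dotProduct_smul, dotProduct_comm, h3]
    simp
  rw [h]
  exact ⟨le_rfl, hLam⟩

/-- The quadratic form of `X` has minimal Pucci operator at most `c`. -/
def PucciLE (lam Lam : ℝ) (X : En n →L[ℝ] En n) (c : ℝ) : Prop :=
  ∀ δ > 0, ∃ (e : OrthonormalBasis (Fin n) ℝ (En n)) (μ : Fin n → ℝ),
    (∀ k, μ k ∈ Icc lam Lam) ∧ -∑ k, μ k * inner ℝ (X (e k)) (e k) < c + δ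

lemma pucciLE_of_pucciMinus_le (hLam : lam ≤ Lam) {X : En n →L[ℝ] En n} {c : ℝ}
    (h : PucciMinus n lam Lam (symMat X) ≤ c) : PucciLE lam Lam X c := by
  intro δ hδ
  obtain ⟨_, ⟨A, ⟨hA, hev⟩, rfl⟩, hlt⟩ :=
    exists_lt_of_csInf_lt ((pucciMatrices_nonempty hLam).image _)
      (h.trans_lt (lt_add_of_pos_right c hδ))
  exact ⟨hA.eigenvectorBasis, hA.eigenvalues, hev, by rwa [← trace_mul_symMat]⟩

lemma PucciLE.mono (hlam : 0 < lam) {X S : En n →L[ℝ] En n} {c : ℝ} (h : PucciLE lam Lam X c)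
    (hXS : ∀ w, inner ℝ (X w) w ≤ inner ℝ (S w) w) : PucciLE lam Lam S c := by
  intro δ hδ
  obtain ⟨e, μ, hμ, hlt⟩ := h δ hδ
  refine ⟨e, μ, hμ, lt_of_le_of_lt (neg_le_neg ?_) hlt⟩
  exact Finset.sum_le_sum fun k _ => mul_le_mul_of_nonneg_left (hXS _) (hlam.le.trans (hμ k).1)

lemma PucciLE.of_add_smul_id {X : En n →L[ℝ] En n} {c τ : ℝ}
    (hτ : 0 ≤ τ) (h : PucciLE lam Lam (X + τ • ContinuousLinearMap.id ℝ (En n)) c) :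
    PucciLE lam Lam X (c + τ * (n * Lam)) := by
  intro δ hδ
  obtain ⟨e, μ, hμ, hlt⟩ := h δ hδ
  refine ⟨e, μ, hμ, ?_⟩
  have h1 : ∑ k, μ k * inner ℝ ((X + τ • ContinuousLinearMap.id ℝ (En n)) (e k)) (e k)
      = ∑ k, μ k * inner ℝ (X (e k)) (e k) + τ * ∑ k, μ k := by
    rw [Finset.mul_sum, ← Finset.sum_add_distrib]
    refine Finset.sum_congr rfl fun k _ => ?_
    simp [inner_add_left, inner_smul_left]
    ring
  have h2 : ∑ k, μ k ≤ n * Lam := by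
    simpa using Finset.sum_le_card_nsmul Finset.univ μ Lam fun k _ => (hμ k).2
  have h3 := mul_le_mul_of_nonneg_left h2 hτ
  linarith

lemma pucciLE_of_forall_pos {X : En n →L[ℝ] En n} {c : ℝ}
    (h : ∀ ε > 0, PucciLE lam Lam X (c + ε)) : PucciLE lam Lam X c := by
  intro δ hδ
  obtain ⟨e, μ, hμ, hlt⟩ := h (δ / 2) (by positivity) (δ / 2) (by positivity)
  exact ⟨e, μ, hμ, by linarith⟩

lemma UniformlyElliptic.pucciLE {F : Mat n → ℝ} (hF : UniformlyElliptic n lam Lam F)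
    (hLam : lam ≤ Lam) {X Y : En n →L[ℝ] En n} {c : ℝ}
    (h : F (symMat X) - F (symMat (-Y)) ≤ c) : PucciLE lam Lam (X + Y) c := by
  refine pucciLE_of_pucciMinus_le hLam (le_trans ?_ h)
  have := (hF (symMat X) (symMat (-Y)) (symMat_isSymm X) (symMat_isSymm (-Y))).1
  rwa [symMat_neg, sub_neg_eq_add, ← symMat_add, ← symMat_neg] at this

end Pucci

section Viscosity

variable {n : ℕ} {F : Mat n → ℝ} {α : ℝ} {u : En n → ℝ}

lemma ViscSubE.le_of_eventually_le_quadPoly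
    (hsub : ViscSubE n Set.univ (Fop n F α (fun _ => 0)) u) {y b : En n} {B : En n →L[ℝ] En n}
    (h : ∀ᶠ z in 𝓝 y, u z ≤ u y + quadPoly b B y z) :
    F (symMat B) - 1 / 2 * inner ℝ b y - α * u y ≤ 0 := by
  have h1 := hsub y (mem_univ y) (quadPoly b B y) (contDiff_quadPoly b B y) (by
    rw [IsLocalMaxOn, nhdsWithin_univ]
    filter_upwards [h] with z hz
    have : quadPoly b B y y = 0 := by simp [quadPoly]
    linarith)
  rw [hess_quadPoly, fderiv_quadPoly_self] at h1
  simpa [Fop] using h1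

lemma ViscSupE.le_of_eventually_quadPoly_le
    (hsup : ViscSupE n Set.univ (Fop n F α (fun _ => 0)) u) {y b : En n} {B : En n →L[ℝ] En n}
    (h : ∀ᶠ z in 𝓝 y, u y + quadPoly b B y z ≤ u z) :
    0 ≤ F (symMat B) - 1 / 2 * inner ℝ b y - α * u y := by
  have h1 := hsup y (mem_univ y) (quadPoly b B y) (contDiff_quadPoly b B y) (by
    rw [IsLocalMinOn, nhdsWithin_univ]
    filter_upwards [h] with z hz
    have : quadPoly b B y y = 0 := by simp [quadPoly]
    linarith)
  rw [hess_quadPoly, fderiv_quadPoly_self] at h1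
  simpa [Fop] using h1

end Viscosity

section TheoremOnSums

variable {n : ℕ} {lam Lam : ℝ} {F : Mat n → ℝ} {α : ℝ} {u V : En n → ℝ}

lemma inner_nonpos_of_eventually {E : Type*} [NormedAddCommGroup E] [InnerProductSpace ℝ E]
    {A : E →L[ℝ] E} {x : E} (h : ∀ᶠ y in 𝓝 x, inner ℝ (A (y - x)) (y - x) ≤ 0) (w : E) :
    inner ℝ (A w) w ≤ 0 := by
  have ht : Tendsto (fun t : ℝ => x + t • w) (𝓝[>] 0) (𝓝 x) := by
    have : Continuous fun t : ℝ => x + t • w := by fun_prop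
    simpa using (this.tendsto 0).mono_left nhdsWithin_le_nhds
  obtain ⟨t, ht1, ht2⟩ := ((ht.eventually h).and self_mem_nhdsWithin).exists
  have ht2 : 0 < t := ht2
  rw [add_sub_cancel_left, map_smul, inner_smul_left, inner_smul_right, conj_trivial] at ht1
  by_contra! hcon
  have : 0 < t * (t * inner ℝ (A w) w) := by positivity
  linarith

/-- The inequality obtained by testing the equations at the points where the sup-convolutions are
attained, when their sum is touched from above by a quadratic polynomial up to a plane. -/
lemma pucciLE_of_contact (hlam : 0 < lam) (hLam : lam ≤ Lam) (hF : UniformlyElliptic n lam Lam F)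
    (hsub : ViscSubE n Set.univ (Fop n F α (fun _ => 0)) u)
    (hsup : ViscSupE n Set.univ (Fop n F α (fun _ => 0)) V)
    {κ : ℝ} {f g : En n → ℝ} {Y Z : En n → En n} (hf : IsSupConvolution κ u f Y)
    (hg : IsSupConvolution κ (fun x => -V x) g Z) {x x₀ b p q : En n} {B B' S : En n →L[ℝ] En n}
    (hS : ∀ x y, inner ℝ (S x) y = inner ℝ (S y) x)
    (hB : HasExpansionAt f p B x) (hB' : HasExpansionAt g q B' x)
    (hW : ∀ᶠ y in 𝓝 x, f y + g y - quadPoly b S x₀ y ≤ f x + g x - quadPoly b S x₀ x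
      + inner ℝ (p + q - (b + S (x - x₀))) (y - x)) :
    PucciLE lam Lam S (1 / 2 * (inner ℝ p (Y x) + inner ℝ q (Z x))
      + α * (u (Y x) - V (Z x))) := by
  have key : ∀ η > 0, PucciLE lam Lam S (1 / 2 * (inner ℝ p (Y x) + inner ℝ q (Z x))
      + α * (u (Y x) - V (Z x)) + 8 * η * (n * Lam)) := by
    intro η hη
    set I := ContinuousLinearMap.id ℝ (En n) with hI
    have h1 : F (symMat (B + (2 * η) • I)) - 1 / 2 * inner ℝ p (Y x) - α * u (Y x) ≤ 0 := by
      refine hsub.le_of_eventually_le_quadPoly ?_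
      filter_upwards [hf.eventually_le hB hη] with y hy
      simp only [quadPoly, hI, _root_.add_apply, _root_.smul_apply, ContinuousLinearMap.id_apply,
        inner_add_left, inner_smul_left, real_inner_self_eq_norm_sq, conj_trivial]
      linarith
    have h2 : 0 ≤ F (symMat (-(B' + (2 * η) • I))) - 1 / 2 * inner ℝ (-q) (Z x)
        - α * V (Z x) := by
      refine hsup.le_of_eventually_quadPoly_le ?_
      filter_upwards [hg.eventually_le hB' hη] with y hy
      simp only [quadPoly, hI, _root_.add_apply, _root_.smul_apply, ContinuousLinearMap.id_apply,
        inner_add_left, inner_smul_left, real_inner_self_eq_norm_sq, conj_trivial,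
        _root_.neg_apply, inner_neg_left]
      linarith
    rw [inner_neg_left] at h2
    have h3 := hF.pucciLE hLam (X := B + (2 * η) • I) (Y := B' + (2 * η) • I)
      (c := 1 / 2 * (inner ℝ p (Y x) + inner ℝ q (Z x)) + α * (u (Y x) - V (Z x))) (by linarith)
    have h4 : ∀ w, inner ℝ ((B + B' - S - (4 * η) • I) w) w ≤ 0 := by
      refine inner_nonpos_of_eventually (x := x) ?_
      filter_upwards [hB η hη, hB' η hη, hW] with y hy1 hy2 hy3
      have h5 := quadPoly_sub (b := b) hS x₀ x y
      have h6 := (abs_le.1 hy1).1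
      have h7 := (abs_le.1 hy2).1
      clear hy1 hy2
      generalize y - x = w at *
      simp only [hI, _root_.add_apply, _root_.sub_apply, _root_.smul_apply,
        ContinuousLinearMap.id_apply, inner_add_left, inner_sub_left, inner_smul_left,
        real_inner_self_eq_norm_sq, conj_trivial] at hy3 h5 ⊢
      linarith
    refine PucciLE.of_add_smul_id (by positivity) (h3.mono hlam fun w => ?_)
    have h5 := h4 w
    simp only [hI, _root_.add_apply, _root_.sub_apply, _root_.smul_apply,
        ContinuousLinearMap.id_apply, inner_add_left, inner_sub_left, inner_smul_left,
        real_inner_self_eq_norm_sq, conj_trivial] at h5 ⊢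
    linarith
  refine pucciLE_of_forall_pos fun ε hε => ?_
  have hd : (0 : ℝ) < 8 * (n * Lam) + 1 := by
    have : 0 < Lam := hlam.trans_le hLam
    positivity
  intro δ hδ
  obtain ⟨e, μ, hμ, hlt⟩ := key (ε / (8 * (n * Lam) + 1)) (by positivity) δ hδ
  refine ⟨e, μ, hμ, hlt.trans_le ?_⟩
  have : 8 * (ε / (8 * (n * Lam) + 1)) * (n * Lam) ≤ ε := by
    rw [show 8 * (ε / (8 * (n * Lam) + 1)) * (n * Lam)
      = ε * ((8 * (n * Lam)) / (8 * (n * Lam) + 1)) by ring]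
    exact mul_le_of_le_one_right hε.le ((div_le_one hd).2 (by linarith))
  linarith

/-- If `u - V`, the difference of a subsolution and a supersolution, is touched from above
by a quadratic polynomial, then the polynomial satisfies the extremal inequality. -/
lemma pucciLE_of_strict_touch (hlam : 0 < lam) (hLam : lam ≤ Lam)
    (hF : UniformlyElliptic n lam Lam F) (hu : Continuous u) (hV : Continuous V) {C : ℝ}
    (huC : ∀ x, u x ≤ C) (hVC : ∀ x, -V x ≤ C)
    (hsub : ViscSubE n Set.univ (Fop n F α (fun _ => 0)) u)
    (hsup : ViscSupE n Set.univ (Fop n F α (fun _ => 0)) V)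
    {x₀ b : En n} {S : En n →L[ℝ] En n} (hS : ∀ x y, inner ℝ (S x) y = inner ℝ (S y) x)
    {τ : ℝ} (hτ : 0 < τ) (h : ∀ᶠ x in 𝓝 x₀,
      u x - V x ≤ u x₀ - V x₀ + quadPoly b S x₀ x - τ * ‖x - x₀‖ ^ 2) :
    PucciLE lam Lam S (1 / 2 * inner ℝ b x₀ + α * (u x₀ - V x₀)) := by
  refine pucciLE_of_forall_pos fun ε hε => ?_
  have hG : ∀ᶠ x in 𝓝 x₀, 1 / 2 * inner ℝ (b + S (x - x₀)) x + α * (u x - V x)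
      < 1 / 2 * inner ℝ b x₀ + α * (u x₀ - V x₀) + ε / 2 := by
    have hc : Continuous fun x => 1 / 2 * inner ℝ (b + S (x - x₀)) x + α * (u x - V x) := by
      fun_prop
    refine hc.continuousAt.eventually_lt_const ?_
    simpa using hε
  obtain ⟨d, hd, hball⟩ := Metric.eventually_nhds_iff.1 (h.and hG)
  set ρ := min (d / 8) 1 with hρd
  have hρ : 0 < ρ := by positivity
  have hρ8 : ρ ≤ d / 8 := min_le_left _ _
  have hρ1 : ρ ≤ 1 := min_le_right _ _
  set r := min (τ * ρ / 16) (ε / (4 * (‖x₀‖ + 1))) with hrd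
  have hr : 0 < r := by positivity
  have hr1 : r ≤ τ * ρ / 16 := min_le_left _ _
  have hr2 : r * (4 * (‖x₀‖ + 1)) ≤ ε := by
    rw [← le_div_iff₀ (by positivity)]; exact min_le_right _ _
  set ε' := min (τ * ρ ^ 2 / 8) (ε / (8 * (1 + |α|))) with hεd
  have hε' : 0 < ε' := by positivity
  have hε1 : ε' ≤ τ * ρ ^ 2 / 8 := min_le_left _ _
  have hε2 : ε' * (8 * (1 + |α|)) ≤ ε := by
    rw [← le_div_iff₀ (by positivity)]; exact min_le_right _ _
  have hV' : Continuous fun x => -V x := hV.neg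
  obtain ⟨κ₁, hκ₁, hclose₁⟩ := exists_forall_supConvolution_close hu huC x₀ (4 * ρ) hε'
  obtain ⟨κ₂, -, hclose₂⟩ := exists_forall_supConvolution_close hV' hVC x₀ (4 * ρ) hε'
  set κ := max κ₁ κ₂ with hκd
  have hκ : 0 < κ := hκ₁.trans_le (le_max_left _ _)
  obtain ⟨f, Y, hf⟩ := exists_isSupConvolution hu huC hκ
  obtain ⟨g, Z, hg⟩ := exists_isSupConvolution hV' hVC hκ
  have hcl₁ := hclose₁ κ (le_max_left _ _) f Y hf
  have hcl₂ := hclose₂ κ (le_max_right _ _) g Z hg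
  have hW := hf.isSemiconvex.add_sub_quadPoly hg.isSemiconvex (b := b) hS x₀
  have hae := (hf.isSemiconvex.ae_hasExpansionAt volume).and
    (hg.isSemiconvex.ae_hasExpansionAt volume)
  obtain ⟨x, hxN, hxρ, hxr, hx⟩ := exists_contact_notMem volume (by positivity) hW hρ hr (by
    intro x hx1 hx2
    obtain ⟨-, -, -, h1⟩ := hcl₁ x hx2
    obtain ⟨-, -, -, h2⟩ := hcl₂ x hx2
    have h3 := (hball (y := x) (by rw [dist_eq_norm]; linarith)).1
    have h4 := hf.self_le x₀
    have h5 := hg.self_le x₀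
    have h6 : quadPoly b S x₀ x₀ = 0 := by simp [quadPoly]
    have h7 : τ * ρ ^ 2 ≤ τ * ‖x - x₀‖ ^ 2 := by gcongr
    have h8 : 4 * ρ * r ≤ 4 * ρ * (τ * ρ / 16) := by gcongr
    nlinarith [mul_pos hτ (pow_pos hρ 2)]) (ae_iff.1 hae)
  simp only [mem_ofPred_eq, not_not] at hxN
  obtain ⟨⟨B, hB⟩, ⟨B', hB'⟩⟩ := hxN
  have hP := pucciLE_of_contact hlam hLam hF hsub hsup hf hg hS hB hB' hx
  have hx4 : ‖x - x₀‖ ≤ 4 * ρ := by linarith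
  obtain ⟨-, ha1, ha2, ha3⟩ := hcl₁ x hx4
  obtain ⟨-, hb1, hb2, hb3⟩ := hcl₂ x hx4
  have hGx := (hball (y := x) (by rw [dist_eq_norm]; linarith)).2
  intro δ hδ
  obtain ⟨e, μ, hμ, hlt⟩ := hP δ hδ
  refine ⟨e, μ, hμ, hlt.trans_le ?_⟩
  set p := κ • (Y x - x) with hp
  set q := κ • (Z x - x) with hq
  have e1 : ∀ w : En n, inner ℝ (κ • (w - x)) w = inner ℝ (κ • (w - x)) x + κ * ‖w - x‖ ^ 2 := by
    intro w
    rw [← real_inner_self_eq_norm_sq, ← sub_eq_iff_eq_add', ← inner_sub_right, inner_smul_left]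
    rfl
  have e2 := e1 (Z x)
  replace e1 := e1 (Y x)
  have e3 : inner ℝ p x + inner ℝ q x ≤ inner ℝ (b + S (x - x₀)) x + r * (‖x₀‖ + 1) := by
    have h1 := real_inner_le_norm (p + q - (b + S (x - x₀))) x
    have h2 : ‖x‖ ≤ ‖x₀‖ + 1 := by
      have : x = x₀ + (x - x₀) := by abel
      rw [this]
      refine (norm_add_le _ _).trans ?_
      linarith
    have h3 : ‖p + q - (b + S (x - x₀))‖ * ‖x‖ ≤ r * (‖x₀‖ + 1) := by gcongr
    rw [inner_sub_left, inner_add_left p] at h1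
    linarith
  have e4 : u x ≤ u (Y x) := by
    have h1 := hf.self_le x
    rw [hf.eq x] at h1
    have : 0 ≤ κ / 2 * ‖Y x - x‖ ^ 2 := by positivity
    linarith
  have e5 : -V x ≤ -V (Z x) := by
    have h1 := hg.self_le x
    rw [hg.eq x] at h1
    have : 0 ≤ κ / 2 * ‖Z x - x‖ ^ 2 := by positivity
    linarith
  have e6 : α * (u (Y x) - V (Z x)) ≤ α * (u x - V x) + |α| * (2 * ε') := by
    have h1 : α * ((u (Y x) - V (Z x)) - (u x - V x)) ≤
        |α| * |(u (Y x) - V (Z x)) - (u x - V x)| := by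
      rw [← abs_mul]; exact le_abs_self _
    have h2 : |(u (Y x) - V (Z x)) - (u x - V x)| ≤ 2 * ε' := by
      rw [abs_le]; constructor <;> linarith
    have h3 := mul_le_mul_of_nonneg_left h2 (abs_nonneg α)
    linarith
  nlinarith

/-- Non-strict version of `pucciLE_of_strict_touch`. -/
lemma pucciLE_of_touch (hlam : 0 < lam) (hLam : lam ≤ Lam)
    (hF : UniformlyElliptic n lam Lam F) (hu : Continuous u) (hV : Continuous V) {C : ℝ}
    (huC : ∀ x, u x ≤ C) (hVC : ∀ x, -V x ≤ C)
    (hsub : ViscSubE n Set.univ (Fop n F α (fun _ => 0)) u)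
    (hsup : ViscSupE n Set.univ (Fop n F α (fun _ => 0)) V)
    {x₀ b : En n} {S : En n →L[ℝ] En n} (hS : ∀ x y, inner ℝ (S x) y = inner ℝ (S y) x)
    (h : ∀ η > 0, ∀ᶠ x in 𝓝 x₀,
      u x - V x ≤ u x₀ - V x₀ + quadPoly b S x₀ x + η * ‖x - x₀‖ ^ 2) :
    PucciLE lam Lam S (1 / 2 * inner ℝ b x₀ + α * (u x₀ - V x₀)) := by
  refine pucciLE_of_forall_pos fun ε hε => ?_
  have hLpos : 0 < Lam := hlam.trans_le hLam
  set η := ε / (4 * (n * Lam + 1)) with hη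
  have hηpos : 0 < η := by positivity
  have h1 := pucciLE_of_strict_touch hlam hLam hF hu hV huC hVC hsub hsup
    (S := S + (4 * η) • ContinuousLinearMap.id ℝ (En n)) (b := b) (x₀ := x₀) (by
      intro x y
      simp only [_root_.add_apply, _root_.smul_apply, ContinuousLinearMap.id_apply,
        inner_add_left, inner_smul_left, conj_trivial, hS x y, real_inner_comm x y]) hηpos (by
      filter_upwards [h η hηpos] with x hx
      simp only [quadPoly, _root_.add_apply, _root_.smul_apply, ContinuousLinearMap.id_apply,
        inner_add_left, inner_smul_left, conj_trivial, real_inner_self_eq_norm_sq] at hx ⊢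
      linarith)
  have h2 := h1.of_add_smul_id (by positivity)
  intro δ hδ
  obtain ⟨e, μ, hμ, hlt⟩ := h2 δ hδ
  refine ⟨e, μ, hμ, hlt.trans_le ?_⟩
  have h3 : 4 * η * (n * Lam + 1) = ε := by rw [hη]; field_simp
  nlinarith

end TheoremOnSums

section RadialBarrier

variable {n : ℕ} {lam Lam α : ℝ} {w : En n → ℝ}

/-- `w` satisfies `P⁻(D²w) - (1/2) y·Dw - α w ≤ 0`, tested with quadratic polynomials touching
from above to second order. -/
def IsExtremalSub (lam Lam α : ℝ) (w : En n → ℝ) : Prop :=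
  ∀ (x₀ b : En n) (S : En n →L[ℝ] En n), (∀ x y, inner ℝ (S x) y = inner ℝ (S y) x) →
    (∀ η > 0, ∀ᶠ x in 𝓝 x₀, w x ≤ w x₀ + quadPoly b S x₀ x + η * ‖x - x₀‖ ^ 2) →
    PucciLE lam Lam S (1 / 2 * inner ℝ b x₀ + α * w x₀)

lemma eventually_abs_taylor_two_le {g g' : ℝ → ℝ} {g'' s₀ : ℝ}
    (hg : ∀ᶠ s in 𝓝 s₀, HasDerivAt g (g' s) s) (hg' : HasDerivAt g' g'' s₀) {η : ℝ} (hη : 0 < η) :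
    ∀ᶠ s in 𝓝 s₀, |g s - g s₀ - g' s₀ * (s - s₀) - g'' / 2 * (s - s₀) ^ 2|
      ≤ η * (s - s₀) ^ 2 := by
  have h1 : ∀ᶠ s in 𝓝 s₀, |g' s - g' s₀ - g'' * (s - s₀)| ≤ η * |s - s₀| := by
    filter_upwards [hg'.isLittleO.def hη] with s hs
    simpa [mul_comm] using hs
  obtain ⟨d, hd, hball⟩ := Metric.eventually_nhds_iff_ball.1 (hg.and h1)
  filter_upwards [ball_mem_nhds s₀ hd] with s hs
  have hsub : closedBall s₀ |s - s₀| ⊆ ball s₀ d := by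
    refine closedBall_subset_ball ?_
    rwa [mem_ball, Real.dist_eq] at hs
  have hmv := Convex.norm_image_sub_le_of_norm_hasDerivWithin_le
    (f := fun s => g s - g' s₀ * (s - s₀) - g'' / 2 * (s - s₀) ^ 2)
    (f' := fun s => g' s - g' s₀ - g'' * (s - s₀)) (C := η * |s - s₀|)
    (s := closedBall s₀ |s - s₀|) (x := s₀) (y := s) (by
      intro r hr
      have hr' := (hball r (hsub hr)).1
      have h2 : HasDerivAt (fun s => s - s₀) 1 r := (hasDerivAt_id r).sub_const s₀
      have h3 := (hr'.sub (h2.const_mul (g' s₀))).sub ((h2.pow 2).const_mul (g'' / 2))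
      refine (h3.congr_deriv ?_).hasDerivWithinAt
      push_cast
      ring) (by
      intro r hr
      refine ((hball r (hsub hr)).2).trans ?_
      rw [mem_closedBall, Real.dist_eq] at hr
      gcongr) (convex_closedBall _ _) (mem_closedBall_self (abs_nonneg _))
      (by rw [mem_closedBall, Real.dist_eq])
  rw [Real.norm_eq_abs, Real.norm_eq_abs, mul_assoc, abs_mul_abs_self, ← sq] at hmv
  convert hmv using 2
  ring

/-- Second order expansion of a radial function. -/
lemma eventually_radial_le {E : Type*} [NormedAddCommGroup E] [InnerProductSpace ℝ E]
    {g g' : ℝ → ℝ} {g'' : ℝ} {x₀ z : E}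
    (hg : ∀ᶠ s in 𝓝 (‖x₀ - z‖ ^ 2), HasDerivAt g (g' s) s)
    (hg' : HasDerivAt g' g'' (‖x₀ - z‖ ^ 2)) {η : ℝ} (hη : 0 < η) :
    ∀ᶠ x in 𝓝 x₀, g (‖x - z‖ ^ 2) ≤ g (‖x₀ - z‖ ^ 2)
      + quadPoly ((2 * g' (‖x₀ - z‖ ^ 2)) • (x₀ - z))
        ((2 * g' (‖x₀ - z‖ ^ 2)) • ContinuousLinearMap.id ℝ E
          + (4 * g'') • (innerSL ℝ (x₀ - z)).smulRight (x₀ - z)) x₀ x + η * ‖x - x₀‖ ^ 2 := by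
  set h := x₀ - z with hh
  set K := (2 * ‖h‖ + 1) ^ 2 with hK
  have hKpos : 0 < K := by positivity
  have ht : Tendsto (fun x : E => ‖x - z‖ ^ 2) (𝓝 x₀) (𝓝 (‖h‖ ^ 2)) :=
    (by fun_prop : Continuous fun x : E => ‖x - z‖ ^ 2).tendsto x₀
  set r := min 1 (η / (2 * (|g''| / 2 * (4 * ‖h‖ + 1) + 1))) with hr
  have hrpos : 0 < r := by positivity
  filter_upwards [ht.eventually (eventually_abs_taylor_two_le hg hg'
    (show 0 < η / (2 * K) by positivity)), ball_mem_nhds x₀ hrpos] with x hx hxr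
  rw [mem_ball, dist_eq_norm] at hxr
  set y := x - x₀ with hy
  have hy1 : ‖y‖ ≤ 1 := hxr.le.trans (min_le_left _ _)
  have hy2 : ‖y‖ * (2 * (|g''| / 2 * (4 * ‖h‖ + 1) + 1)) ≤ η := by
    rw [← le_div_iff₀ (by positivity)]; exact hxr.le.trans (min_le_right _ _)
  have hσ : ‖x - z‖ ^ 2 - ‖h‖ ^ 2 = 2 * inner ℝ h y + ‖y‖ ^ 2 := by
    have : x - z = h + y := by rw [hh, hy]; abel
    rw [this, norm_add_sq_real]; ring
  rw [hσ] at hx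
  have hin := abs_real_inner_le_norm h y
  set i := inner ℝ h y with hi
  have hσK : (2 * i + ‖y‖ ^ 2) ^ 2 ≤ K * ‖y‖ ^ 2 := by
    have h1 : |2 * i + ‖y‖ ^ 2| ≤ (2 * ‖h‖ + 1) * ‖y‖ := by
      refine (abs_add_le _ _).trans ?_
      rw [abs_mul, abs_two, abs_of_nonneg (sq_nonneg ‖y‖)]
      nlinarith [norm_nonneg y]
    rw [hK, ← mul_pow, ← sq_abs]
    gcongr
  have hR : η / (2 * K) * (2 * i + ‖y‖ ^ 2) ^ 2 ≤ η / 2 * ‖y‖ ^ 2 := by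
    calc _ ≤ η / (2 * K) * (K * ‖y‖ ^ 2) := by gcongr
      _ = _ := by field_simp
  have hcub : g'' / 2 * (4 * i * ‖y‖ ^ 2 + ‖y‖ ^ 4) ≤ η / 2 * ‖y‖ ^ 2 := by
    have h1 : |4 * i + ‖y‖ ^ 2| ≤ (4 * ‖h‖ + 1) * ‖y‖ := by
      refine (abs_add_le _ _).trans ?_
      rw [abs_mul, abs_of_nonneg (sq_nonneg ‖y‖), abs_of_nonneg (by norm_num : (0 : ℝ) ≤ 4)]
      nlinarith [norm_nonneg y]
    have h2 : g'' / 2 * (4 * i + ‖y‖ ^ 2) ≤ |g''| / 2 * ((4 * ‖h‖ + 1) * ‖y‖) := by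
      refine (le_abs_self _).trans ?_
      rw [abs_mul, abs_div, abs_two]
      gcongr
    have h3 : g'' / 2 * (4 * i + ‖y‖ ^ 2) ≤ η / 2 := by
      have := norm_nonneg y
      linarith
    have h4 := mul_le_mul_of_nonneg_right h3 (sq_nonneg ‖y‖)
    linarith
  have hup := (abs_le.1 hx).2
  have hq : quadPoly ((2 * g' (‖h‖ ^ 2)) • h) ((2 * g' (‖h‖ ^ 2)) • ContinuousLinearMap.id ℝ E
          + (4 * g'') • (innerSL ℝ h).smulRight h) x₀ x
      = g' (‖h‖ ^ 2) * (2 * i + ‖y‖ ^ 2) + 2 * g'' * i ^ 2 := by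
    simp only [quadPoly, _root_.add_apply, _root_.smul_apply, ContinuousLinearMap.id_apply,
      ContinuousLinearMap.smulRight_apply, innerSL_apply_apply, inner_add_left, inner_smul_left,
      conj_trivial, real_inner_self_eq_norm_sq, ← hy, ← hi]
    ring
  rw [hq]
  linarith

lemma sum_mul_inner_sq_mem_Icc (e : OrthonormalBasis (Fin n) ℝ (En n))
    {μ : Fin n → ℝ} (hμ : ∀ k, μ k ∈ Icc lam Lam) (h : En n) :
    ∑ k, μ k * inner ℝ h (e k) ^ 2 ∈ Icc (lam * ‖h‖ ^ 2) (Lam * ‖h‖ ^ 2) := by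
  have h1 : ∑ k, inner ℝ h (e k) ^ 2 = ‖h‖ ^ 2 := by
    simpa using e.sum_sq_norm_inner_left h
  rw [← h1, Finset.mul_sum, Finset.mul_sum]
  exact ⟨Finset.sum_le_sum fun k _ => mul_le_mul_of_nonneg_right (hμ k).1 (sq_nonneg _),
    Finset.sum_le_sum fun k _ => mul_le_mul_of_nonneg_right (hμ k).2 (sq_nonneg _)⟩

/-- Testing with a multiple of the radial barrier `‖x - z‖ ^ (-2 * k)`. -/
lemma IsExtremalSub.exists_of_radial_touch (hw : IsExtremalSub lam Lam α w)
    {k m : ℝ} {x₀ z : En n} (hne : x₀ ≠ z)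
    (h : ∀ᶠ x in 𝓝 x₀, w x ≤ w x₀ + m * ((‖x - z‖ ^ 2) ^ (-k) - (‖x₀ - z‖ ^ 2) ^ (-k)))
    {δ : ℝ} (hδ : 0 < δ) :
    ∃ A ∈ Icc lam Lam, ∃ T ∈ Icc (n * lam) (n * Lam),
      -(m * ((‖x₀ - z‖ ^ 2) ^ (-k) / ‖x₀ - z‖ ^ 2)) *
        (4 * k * (k + 1) * A - 2 * k * T - k * inner ℝ (x₀ - z) x₀) < α * w x₀ + δ := by
  have hspos : 0 < ‖x₀ - z‖ ^ 2 := by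
    have := norm_pos_iff.2 (sub_ne_zero.2 hne)
    positivity
  set s := ‖x₀ - z‖ ^ 2 with hs
  set P := s ^ (-k) / s with hP
  have hd1 : ∀ᶠ r in 𝓝 s, HasDerivAt (fun r => m * r ^ (-k)) (m * (-k * r ^ (-k - 1))) r := by
    filter_upwards [lt_mem_nhds hspos] with r hr
    exact (Real.hasDerivAt_rpow_const (Or.inl hr.ne')).const_mul m
  have hd2 : HasDerivAt (fun r : ℝ => m * (-k * r ^ (-k - 1)))
      (m * (-k * ((-k - 1) * s ^ (-k - 1 - 1)))) s :=
    ((Real.hasDerivAt_rpow_const (Or.inl hspos.ne')).const_mul _).const_mul m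
  have hP1 : s ^ (-k - 1) = P := by rw [hP, Real.rpow_sub_one hspos.ne']
  have hP2 : s ^ (-k - 1 - 1) = P / s := by rw [Real.rpow_sub_one hspos.ne', hP1]
  rw [hP2] at hd2
  set c := m * (-k * P) with hc
  set c' := m * (-k * ((-k - 1) * (P / s))) with hc'
  have hPL := hw x₀ ((2 * c) • (x₀ - z)) ((2 * c) • ContinuousLinearMap.id ℝ (En n)
      + (4 * c') • (innerSL ℝ (x₀ - z)).smulRight (x₀ - z)) (by
    intro x y
    simp only [_root_.add_apply, _root_.smul_apply, ContinuousLinearMap.id_apply,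
      ContinuousLinearMap.smulRight_apply, innerSL_apply_apply, inner_add_left, inner_smul_left,
      conj_trivial, real_inner_comm x y]
    ring) (by
    intro η hη
    have h1 := eventually_radial_le (x₀ := x₀) (z := z) hd1 hd2 hη
    simp only [← hs, hP1, ← hc] at h1
    filter_upwards [h, h1] with x hx hx1
    linarith)
  obtain ⟨e, μ, hμ, hlt⟩ := hPL δ hδ
  have hA := sum_mul_inner_sq_mem_Icc e hμ (x₀ - z)
  rw [← hs] at hA
  have hT1 : n * lam ≤ ∑ k, μ k := by
    simpa using Finset.card_nsmul_le_sum Finset.univ μ lam fun k _ => (hμ k).1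
  have hT2 : ∑ k, μ k ≤ n * Lam := by
    simpa using Finset.sum_le_card_nsmul Finset.univ μ Lam fun k _ => (hμ k).2
  refine ⟨(∑ k, μ k * inner ℝ (x₀ - z) (e k) ^ 2) / s,
    ⟨(le_div_iff₀ hspos).2 hA.1, (div_le_iff₀ hspos).2 hA.2⟩, ∑ k, μ k, ⟨hT1, hT2⟩, ?_⟩
  have hsum : ∑ k, μ k * inner ℝ (((2 * c) • ContinuousLinearMap.id ℝ (En n)
      + (4 * c') • (innerSL ℝ (x₀ - z)).smulRight (x₀ - z)) (e k)) (e k)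
      = 2 * c * ∑ k, μ k + 4 * c' * ∑ k, μ k * inner ℝ (x₀ - z) (e k) ^ 2 := by
    rw [Finset.mul_sum, Finset.mul_sum, ← Finset.sum_add_distrib]
    refine Finset.sum_congr rfl fun k _ => ?_
    simp only [_root_.add_apply, _root_.smul_apply, ContinuousLinearMap.id_apply,
      ContinuousLinearMap.smulRight_apply, innerSL_apply_apply, inner_add_left, inner_smul_left,
      conj_trivial, real_inner_self_eq_norm_sq, e.orthonormal.1 k]
    ring
  rw [hsum, inner_smul_left, conj_trivial] at hlt
  have hcc : c' = m * P * (k * (k + 1)) / s := by rw [hc']; ring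
  rw [hcc, hc] at hlt
  calc _ = -(2 * (m * (-k * P)) * ∑ k, μ k + 4 * (m * P * (k * (k + 1)) / s) *
        ∑ k, μ k * inner ℝ (x₀ - z) (e k) ^ 2)
        - 1 / 2 * (2 * (m * (-k * P)) * inner ℝ (x₀ - z) x₀) := by ring
    _ < _ := by linarith

end RadialBarrier

section MaximumPrinciples

variable {n : ℕ} {lam Lam α : ℝ} {w : En n → ℝ}

lemma tendsto_rpow_mul_exp_cocompact {C a q k : ℝ} (hC : 0 < C) (ha : 0 < a) (hq : 1 < q) :
    Tendsto (fun y : En n => (‖y‖ ^ 2) ^ k * (C * Real.exp (-a * ‖y‖ ^ q))) (cocompact (En n))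
      (𝓝 0) := by
  have h1 : Tendsto (fun r : ℝ => C * (r ^ (2 * k) * Real.exp (-a * r))) atTop (𝓝 0) := by
    simpa using (tendsto_rpow_mul_exp_neg_mul_atTop_nhds_zero (2 * k) a ha).const_mul C
  refine squeeze_zero' (Eventually.of_forall fun y => by positivity) ?_
    (h1.comp (tendsto_norm_cocompact_atTop (E := En n)))
  filter_upwards [(tendsto_norm_cocompact_atTop (E := En n)).eventually_ge_atTop 1] with y hy
  have h2 : (‖y‖ ^ 2) ^ k = ‖y‖ ^ (2 * k) := by
    rw [Real.rpow_mul (norm_nonneg y), Real.rpow_two]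
  have h3 : ‖y‖ ≤ ‖y‖ ^ q := by
    simpa using Real.rpow_le_rpow_of_exponent_le hy hq.le
  have h4 : Real.exp (-a * ‖y‖ ^ q) ≤ Real.exp (-a * ‖y‖) := by
    apply Real.exp_le_exp.2; nlinarith
  have h5 : 0 ≤ ‖y‖ ^ (2 * k) := by positivity
  simp only [Function.comp, h2]
  calc _ = C * (‖y‖ ^ (2 * k) * Real.exp (-a * ‖y‖ ^ q)) := by ring
    _ ≤ _ := by gcongr

/-- Maximum principle in exterior domains for rapidly decaying subsolutions. -/
lemma exists_forall_nonpos_of_nonpos_closedBall (hlam : 0 < lam) (hLam : lam ≤ Lam) (α : ℝ) :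
    ∃ R > 0, ∀ w : En n → ℝ, Continuous w → IsExtremalSub lam Lam α w →
      ∀ C a q : ℝ, 0 < C → 0 < a → 1 < q → (∀ y, w y ≤ C * Real.exp (-a * ‖y‖ ^ q)) →
      (∀ y, ‖y‖ ≤ R → w y ≤ 0) → ∀ y, w y ≤ 0 := by
  set k := |α| + 1 with hk
  have hkpos : 0 < k := by positivity
  have hLpos : 0 < Lam := hlam.trans_le hLam
  refine ⟨4 * k * (k + 1) * Lam + 1, by positivity, ?_⟩
  intro w hwc hw C a q hC ha hq hdec hball
  by_contra! hcon
  obtain ⟨y₁, hy₁⟩ := hcon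
  have hy₁n : 4 * k * (k + 1) * Lam + 1 < ‖y₁‖ := by
    by_contra! hc
    exact absurd (hball y₁ hc) (not_le.2 hy₁)
  set Φ : En n → ℝ := fun y => (‖y‖ ^ 2) ^ k * w y with hΦ
  have hΦc : Continuous Φ :=
    ((continuous_norm.pow 2).rpow_const fun _ => Or.inr hkpos.le).mul hwc
  have hn₁ : 0 < ‖y₁‖ := lt_trans (by positivity) hy₁n
  have hΦ1 : 0 < Φ y₁ := by positivity
  obtain ⟨x₀, hx₀⟩ := hΦc.exists_forall_ge' y₁ (by
    filter_upwards [(tendsto_rpow_mul_exp_cocompact (n := n) (k := k) hC ha hq).eventually_le_const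
      hΦ1] with y hy
    refine le_trans ?_ hy
    have := hdec y
    simp only [hΦ]
    gcongr)
  have hm : 0 < Φ x₀ := hΦ1.trans_le (hx₀ y₁)
  have hw₀ : 0 < w x₀ := by
    by_contra! hc
    exact absurd hm (not_lt.2 (mul_nonpos_of_nonneg_of_nonpos (by positivity) hc))
  have hx₀n : 4 * k * (k + 1) * Lam + 1 < ‖x₀‖ := by
    by_contra! hc
    exact absurd (hball x₀ hc) (not_le.2 hw₀)
  have h1 : 1 < ‖x₀‖ := lt_of_le_of_lt (by
    have : 0 ≤ 4 * k * (k + 1) * Lam := by positivity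
    linarith) hx₀n
  have hne : x₀ ≠ 0 := norm_pos_iff.1 (by linarith)
  have hdiv : ∀ y : En n, y ≠ 0 → w y = Φ y * (‖y - 0‖ ^ 2) ^ (-k) := by
    intro y hy
    have : 0 < ‖y‖ ^ 2 := by have := norm_pos_iff.2 hy; positivity
    simp only [hΦ, sub_zero]
    rw [mul_right_comm, ← Real.rpow_add this]
    simp
  set s := ‖x₀ - 0‖ ^ 2 with hs
  have hspos : 0 < s := by rw [hs, sub_zero]; positivity
  have hpow : 0 < s ^ (-k) := by positivity
  obtain ⟨A, hA, T, hT, hlt⟩ := hw.exists_of_radial_touch (m := Φ x₀) (k := k) hne (by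
    filter_upwards [isOpen_ne.mem_nhds hne] with x hx
    have e1 := hdiv x hx
    have e2 := hdiv x₀ hne
    have e3 : Φ x * (‖x - 0‖ ^ 2) ^ (-k) ≤ Φ x₀ * (‖x - 0‖ ^ 2) ^ (-k) := by
      have := hx₀ x
      gcongr
    linarith) (δ := Φ x₀ * (s ^ (-k) / s)) (by positivity)
  rw [← hs] at hlt
  set P := s ^ (-k) / s with hP
  have hPs : s ^ (-k) = P * s := by rw [hP]; field_simp
  have hin : inner ℝ (x₀ - 0) x₀ = s := by rw [hs, sub_zero, real_inner_self_eq_norm_sq]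
  rw [hdiv x₀ hne, ← hs, hPs, hin] at hlt
  have hPpos : 0 < P := by positivity
  have hmP : 0 < Φ x₀ * P := by positivity
  have hlt2 : k * s - α * s - 1 < 4 * k * (k + 1) * A - 2 * k * T := by
    refine lt_of_mul_lt_mul_left (a := Φ x₀ * P) ?_ hmP.le
    linarith
  have hT0 : 0 ≤ T := le_trans (by positivity) hT.1
  have hA1 : 4 * k * (k + 1) * A ≤ 4 * k * (k + 1) * Lam := by
    have := hA.2
    gcongr
  have hkT : 0 ≤ k * T := by positivity
  have hαs : α * s ≤ |α| * s := by gcongr; exact le_abs_self α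
  have hs1 : ‖x₀‖ ≤ s := by rw [hs, sub_zero]; nlinarith
  have hks : k * s = |α| * s + s := by rw [hk]; ring
  linarith

set_option maxHeartbeats 1000000 in
/-- Strong maximum principle. -/
lemma IsExtremalSub.eq_zero_of_nonpos (hlam : 0 < lam) (hLam : lam ≤ Lam)
    (hw : IsExtremalSub lam Lam α w) (hwc : Continuous w) (hw0 : ∀ y, w y ≤ 0) {y₀ : En n}
    (hy₀ : w y₀ = 0) (z : En n) : w z = 0 := by
  by_contra hz
  have hLpos : 0 < Lam := hlam.trans_le hLam
  set Z : Set (En n) := {y | w y = 0} with hZ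
  have hZc : IsClosed Z := isClosed_eq hwc continuous_const
  obtain ⟨y₁, hy₁, hdist⟩ := hZc.exists_infDist_eq_dist ⟨y₀, hy₀⟩ z
  set R := infDist z Z with hR
  have hRpos : 0 < R := by
    rw [hdist, dist_pos]
    rintro rfl
    exact hz hy₁
  have hneg : ∀ x, ‖x - z‖ < R → w x < 0 := by
    intro x hx
    refine lt_of_le_of_ne (hw0 x) fun h => ?_
    have : infDist z Z ≤ dist z x := infDist_le_dist_of_mem h
    rw [dist_comm, dist_eq_norm] at this
    linarith
  have hy₁R : ‖y₁ - z‖ = R := by rw [hdist, dist_comm, dist_eq_norm]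
  set M := 2 * (n * Lam) + R * (‖z‖ + R) + |α| * R ^ 2 + 1 with hM
  have hMpos : 0 < M := by positivity
  set k := M / lam + 1 with hk
  have hk1 : 1 ≤ k := by
    have : 0 < M / lam := by positivity
    linarith
  have hkpos : 0 < k := by linarith
  obtain ⟨xm, hxm, hmax⟩ := (isCompact_closedBall z (R / 2)).exists_isMaxOn
    ⟨z, mem_closedBall_self (by positivity)⟩ hwc.continuousOn
  have hxmneg : w xm < 0 := hneg xm (by
    rw [mem_closedBall, dist_eq_norm] at hxm; linarith)
  set ψ : En n → ℝ := fun x => (‖x - z‖ ^ 2) ^ (-k) with hψ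
  set ψR : ℝ := (R ^ 2) ^ (-k) with hψR
  set ψ2 : ℝ := ((R / 2) ^ 2) ^ (-k) with hψ2
  have hψ2pos : 0 < ψ2 := by positivity
  have hψRpos : 0 < ψR := by positivity
  set m := -w xm / (2 * ψ2) with hm
  have hmpos : 0 < m := div_pos (by linarith) (by positivity)
  have hmψ : m * ψ2 = -w xm / 2 := by rw [hm]; field_simp
  set K : Set (En n) := {x | R / 2 ≤ ‖x - z‖ ∧ ‖x - z‖ ≤ R} with hK
  have hnc : Continuous fun x : En n => ‖x - z‖ := by fun_prop
  have hKcl : IsClosed K :=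
    (isClosed_le continuous_const hnc).inter (isClosed_le hnc continuous_const)
  have hKcpt : IsCompact K :=
    (isCompact_closedBall z R).of_isClosed_subset hKcl fun x hx => by
      rw [mem_closedBall, dist_eq_norm]; exact hx.2
  have hψc : ContinuousOn ψ K := by
    refine ContinuousOn.rpow_const (by fun_prop) fun x hx => Or.inl ?_
    have : 0 < ‖x - z‖ := lt_of_lt_of_le (by positivity) hx.1
    positivity
  obtain ⟨x₀, hx₀K, hx₀⟩ := hKcpt.exists_isMaxOn (f := fun x => w x + m * (ψ x - ψR))
    ⟨y₁, by rw [hK]; exact ⟨by rw [hy₁R]; linarith, hy₁R.le⟩⟩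
    (hwc.continuousOn.add ((hψc.sub continuousOn_const).const_smul m))
  have hθ : 0 ≤ w x₀ + m * (ψ x₀ - ψR) := by
    have h1 : w y₁ + m * (ψ y₁ - ψR) ≤ w x₀ + m * (ψ x₀ - ψR) :=
      hx₀ ⟨by rw [hy₁R]; linarith, hy₁R.le⟩
    have h2 : ψ y₁ = ψR := by simp only [hψ, hψR, hy₁R]
    have h3 : w y₁ = 0 := hy₁
    rw [h2, h3] at h1
    linarith
  have hx₀gt : R / 2 < ‖x₀ - z‖ := by
    refine lt_of_le_of_ne hx₀K.1 fun h => ?_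
    have h1 : ψ x₀ = ψ2 := by simp only [hψ, hψ2, ← h]
    have h2 : w x₀ ≤ w xm := hmax (by rw [mem_closedBall, dist_eq_norm]; exact h.symm.le)
    rw [h1] at hθ
    have h3 := mul_pos hmpos hψRpos
    linarith
  have hne : x₀ ≠ z := by
    rintro rfl
    rw [sub_self, norm_zero] at hx₀gt
    linarith
  set s := ‖x₀ - z‖ ^ 2 with hs
  have hspos : 0 < s := by
    have : 0 < ‖x₀ - z‖ := lt_trans (by positivity) hx₀gt
    positivity
  have hpow : 0 < s ^ (-k) := by positivity
  obtain ⟨A, hA, T, hT, hlt⟩ := hw.exists_of_radial_touch (m := -m) (k := k) hne (by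
    have hev : ∀ᶠ x in 𝓝 x₀, R / 2 < ‖x - z‖ :=
      hnc.continuousAt.eventually_const_lt hx₀gt
    filter_upwards [hev] with x hx
    have hgoal : w x + m * (ψ x - ψR) ≤ w x₀ + m * (ψ x₀ - ψR) := by
      by_cases hxR : ‖x - z‖ ≤ R
      · exact hx₀ ⟨hx.le, hxR⟩
      · push Not at hxR
        refine le_trans ?_ hθ
        have h1 : ψ x ≤ ψR :=
          Real.rpow_le_rpow_of_nonpos (by positivity) (by gcongr) (by linarith)
        have h2 := hw0 x
        nlinarith
    simp only [hψ] at hgoal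
    linarith) (δ := m * (s ^ (-k) / s)) (by positivity)
  rw [← hs] at hlt
  set P := s ^ (-k) / s with hP
  have hPs : ψ x₀ = P * s := by simp only [hψ, hP, ← hs]; field_simp
  have hPpos : 0 < P := by positivity
  have hmP : 0 < m * P := by positivity
  have hαw : α * w x₀ ≤ |α| * (m * (P * s)) := by
    have h1 : |w x₀| ≤ m * (P * s) := by
      rw [abs_of_nonpos (hw0 x₀), ← hPs]
      have := mul_pos hmpos hψRpos
      linarith
    calc α * w x₀ ≤ |α| * |w x₀| := by rw [← abs_mul]; exact le_abs_self _
      _ ≤ _ := by gcongr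
  have hlt2 : 4 * k * (k + 1) * A - 2 * k * T - k * inner ℝ (x₀ - z) x₀ < |α| * s + 1 := by
    refine lt_of_mul_lt_mul_left (a := m * P) ?_ hmP.le
    linarith
  have hsR : s ≤ R ^ 2 := by rw [hs]; gcongr; exact hx₀K.2
  have hin : inner ℝ (x₀ - z) x₀ ≤ R * (‖z‖ + R) := by
    refine (real_inner_le_norm _ _).trans ?_
    have : ‖x₀‖ ≤ ‖z‖ + R := by
      have h1 : x₀ = z + (x₀ - z) := by abel
      rw [h1]
      refine (norm_add_le _ _).trans ?_
      gcongr
      exact hx₀K.2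
    gcongr
    exact hx₀K.2
  have hA1 : 4 * (k + 1) * lam ≤ 4 * (k + 1) * A := by
    have := hA.1
    gcongr
  have hkl : M ≤ k * lam := by
    rw [hk, add_mul, div_mul_cancel₀ _ hlam.ne']
    linarith
  have hαR : |α| * s ≤ |α| * R ^ 2 := by gcongr
  have hfin : |α| * R ^ 2 + 1 ≤ 4 * (k + 1) * A - 2 * T - inner ℝ (x₀ - z) x₀ := by
    have h1 := hT.2
    have h2 := mul_pos hkpos hlam
    linarith
  have hnn : 0 ≤ |α| * R ^ 2 + 1 := by positivity
  have h1 := mul_le_mul_of_nonneg_left hfin hkpos.le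
  have h2 := le_mul_of_one_le_left hnn hk1
  linarith

end MaximumPrinciples

section Scaling

variable {n : ℕ} {F : Mat n → ℝ} {α : ℝ}

lemma ViscSupE.const_mul (hFh : PositivelyHomogeneous n F) {v : En n → ℝ}
    (hsup : ViscSupE n Set.univ (Fop n F α (fun _ => 0)) v) {t : ℝ} (ht : 0 < t) :
    ViscSupE n Set.univ (Fop n F α (fun _ => 0)) fun y => t * v y := by
  intro y hy φ hφ hmin
  have h1 := hsup y hy (fun x => t⁻¹ * φ x) (contDiff_const.mul hφ) (by
    filter_upwards [hmin] with x hx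
    have h2 := mul_le_mul_of_nonneg_left hx (inv_nonneg.2 ht.le)
    have h3 : ∀ x, t⁻¹ * (t * v x - φ x) = v x - t⁻¹ * φ x := fun x => by field_simp
    rwa [h3, h3] at h2)
  have hfd : ∀ x, fderiv ℝ (fun x => t⁻¹ * φ x) x = t⁻¹ • fderiv ℝ φ x := fun x =>
    fderiv_const_mul (hφ.differentiable (by norm_num)).differentiableAt t⁻¹
  have hhess : hess n (fun x => t⁻¹ * φ x) y = t⁻¹ • hess n φ y := by
    have hd : Differentiable ℝ (fderiv ℝ φ) :=
      (hφ.fderiv_right (m := 1) (by norm_num)).differentiable (by norm_num)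
    ext i j
    simp only [hess, hfd, Matrix.of_apply, Matrix.smul_apply, _root_.smul_apply, smul_eq_mul]
    rw [fderiv_const_mul (hd.differentiableAt.clm_apply (differentiableAt_const _))]
    rfl
  rw [hhess, hfd] at h1
  simp only [Fop, hFh _ _ (inv_nonneg.2 ht.le), _root_.smul_apply, smul_eq_mul] at h1 ⊢
  have h2 := mul_nonneg ht.le h1
  have h3 : t * (t⁻¹ * F (hess n φ y) - 1 / 2 * (t⁻¹ * fderiv ℝ φ y y) - α * v y - 0)
      = F (hess n φ y) - 1 / 2 * fderiv ℝ φ y y - α * (t * v y) - 0 := by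
    field_simp
    ring
  rwa [h3] at h2

end Scaling

/-- The difference of a subsolution and a positive supersolution of a homogeneous equation is a
subsolution of the associated extremal equation. -/
lemma isExtremalSub_sub_const_mul {n : ℕ} {lam Lam : ℝ} (hlam : 0 < lam) (hLam : lam ≤ Lam)
    {F : Mat n → ℝ} (hF : UniformlyElliptic n lam Lam F) (hFh : PositivelyHomogeneous n F)
    {u v : En n → ℝ} {α : ℝ} (hu : Continuous u) (hv : Continuous v)
    (hsub : ViscSubE n Set.univ (Fop n F α (fun _ => 0)) u)
    (hsup : ViscSupE n Set.univ (Fop n F α (fun _ => 0)) v) (hvpos : ∀ y, 0 < v y)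
    {C : ℝ} (hC : 0 ≤ C) (huC : ∀ y, u y ≤ C) {t : ℝ} (ht : 0 < t) :
    IsExtremalSub lam Lam α fun y => u y - t * v y :=
  fun _ _ _ hS h => pucciLE_of_touch hlam hLam hF hu (hv.const_mul t) huC
    (fun x => (neg_nonpos.2 (mul_pos ht (hvpos x)).le).trans hC) hsub (hsup.const_mul hFh ht) hS h

/-- **Corollary 3.3.** If `F(D²u) - (1/2)y·Du - αu ≤ 0 ≤ F(D²v) - (1/2)y·Dv - αv` in `ℝⁿ`
with `v > 0` and `u` of superexponential decay, then either `u ≤ 0` in `ℝⁿ` or `u ≡ t v`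
for some `t > 0`. -/
theorem parabolic_HCP_cor (n : ℕ) (hn : 1 ≤ n) (lam Lam : ℝ) (hlam : 0 < lam) (hLam : lam ≤ Lam)
    (F : Mat n → ℝ) (hF : UniformlyElliptic n lam Lam F) (hFh : PositivelyHomogeneous n F)
    (u v : En n → ℝ) (α : ℝ)
    (hu : Continuous u) (hv : Continuous v)
    (hsub : ViscSubE n Set.univ (Fop n F α (fun _ => 0)) u)
    (hsup : ViscSupE n Set.univ (Fop n F α (fun _ => 0)) v)
    (hvpos : ∀ y, 0 < v y)
    (C a q : ℝ) (hC : 0 < C) (ha : 0 < a) (hq : 1 < q)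
    (hdecay : ∀ y : En n, u y ≤ C * Real.exp (-a * ‖y‖ ^ q)) :
    (∀ y, u y ≤ 0) ∨ ∃ t : ℝ, 0 < t ∧ ∀ y, u y = t * v y := by
  have huC : ∀ y, u y ≤ C := fun y => by
    refine (hdecay y).trans (mul_le_of_le_one_right hC.le (Real.exp_le_one_iff.2 ?_))
    rw [neg_mul, neg_nonpos]
    positivity
  have hext : ∀ t > 0, IsExtremalSub lam Lam α fun y => u y - t * v y := fun t ht =>
    isExtremalSub_sub_const_mul hlam hLam hF hFh hu hv hsub hsup hvpos hC.le huC ht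
  have hcont : ∀ t, Continuous fun y => u y - t * v y := fun t => hu.sub (hv.const_mul t)
  by_cases hu0 : ∀ y, u y ≤ 0
  · exact Or.inl hu0
  push Not at hu0
  obtain ⟨y₁, hy₁⟩ := hu0
  right
  obtain ⟨R, hR, hmp⟩ := exists_forall_nonpos_of_nonpos_closedBall (n := n) hlam hLam α
  have hball : ∀ t > 0, (∀ y, ‖y‖ ≤ R → u y ≤ t * v y) → ∀ y, u y ≤ t * v y := by
    intro t ht h y
    refine sub_nonpos.1 (hmp _ (hcont t) (hext t ht) C a q hC ha hq (fun y => ?_)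
      (fun y hy => sub_nonpos.2 (h y hy)) y)
    have := mul_pos ht (hvpos y)
    linarith [hdecay y]
  obtain ⟨p, -, hp⟩ := (isCompact_closedBall (0 : En n) R).exists_isMaxOn
    ⟨0, mem_closedBall_self hR.le⟩ (hu.div hv fun y => (hvpos y).ne').continuousOn
  have hmax : ∀ t > 0, u p / v p ≤ t → ∀ y, u y ≤ t * v y := by
    intro t ht hpt
    refine hball t ht fun y hy => (div_le_iff₀ (hvpos y)).1 (le_trans ?_ hpt)
    exact hp (mem_closedBall_zero_iff.2 hy)
  set S : Set ℝ := {t | 0 < t ∧ ∀ y, u y ≤ t * v y} with hS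
  have hSne : S.Nonempty :=
    ⟨max (u p / v p) 1, by positivity, hmax _ (by positivity) (le_max_left _ _)⟩
  have hSlb : ∀ t ∈ S, ∀ y, u y / v y ≤ t := fun t ht y => (div_le_iff₀ (hvpos y)).2 (ht.2 y)
  have hSbdd : BddBelow S := ⟨0, fun t ht => ht.1.le⟩
  set T := sInf S with hT
  have hTv : ∀ y, u y ≤ T * v y := fun y =>
    (div_le_iff₀ (hvpos y)).1 (le_csInf hSne fun t ht => hSlb t ht y)
  have hTpos : 0 < T :=
    (div_pos hy₁ (hvpos y₁)).trans_le (le_csInf hSne fun t ht => hSlb t ht y₁)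
  by_cases hz : ∃ y₀, u y₀ = T * v y₀
  · obtain ⟨y₀, hy₀⟩ := hz
    exact ⟨T, hTpos, fun y => sub_eq_zero.1 ((hext T hTpos).eq_zero_of_nonpos hlam hLam (hcont T)
      (fun y => sub_nonpos.2 (hTv y)) (sub_eq_zero.2 hy₀) y)⟩
  · push Not at hz
    have hpT : u p / v p < T :=
      (div_lt_iff₀ (hvpos p)).2 (lt_of_le_of_ne (hTv p) (hz p))
    have ht' : 0 < max (u p / v p) (T / 2) := lt_max_of_lt_right (half_pos hTpos)
    have hle : T ≤ max (u p / v p) (T / 2) := csInf_le hSbdd ⟨ht', hmax _ ht' (le_max_left _ _)⟩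
    exact absurd hle (not_le.2 (max_lt hpT (half_lt_self hTpos)))
end
end

section
/- Let φ^a(y) := exp(−a|y|²) for y ∈ ℝⁿ. For a = 1/(4Λ), the function φ^a satisfies the pointwise inequalities (nλ/(2Λ)) φ^a(y) ≤ P⁻(D²φ^a(y)) − (1/2) y·Dφ^a(y) ≤ ((n−1)λ/(2Λ) + 1/2) φ^a(y) for all y ∈ ℝⁿ. Likewise, for a = 1/(4λ), the function φ^a satisfies ((n−1)Λ/(2λ) + 1/2) φ^a(y) ≤ P⁺(D²φ^a(y)) − (1/2) y·Dφ^a(y) ≤ (nΛ/(2λ)) φ^a(y) for all y ∈ ℝⁿ. -/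
noncomputable section

open Filter Matrix Real Set
open scoped Topology

/-- The Rayleigh quotient of a matrix in `PucciMatrices` lies in `[lam, Lam]`. -/
lemma PucciMatrices.dotProduct_mulVec_mem {n : ℕ} {lam Lam : ℝ} {A : Mat n}
    (hA : A ∈ PucciMatrices n lam Lam) (x : En n) :
    lam * ‖x‖ ^ 2 ≤ x.ofLp ⬝ᵥ A *ᵥ x.ofLp ∧ x.ofLp ⬝ᵥ A *ᵥ x.ofLp ≤ Lam * ‖x‖ ^ 2 := by
  obtain ⟨hH, hev⟩ := hA
  set b := hH.eigenvectorBasis with hb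
  have hcoef (i : Fin n) : (b i).ofLp ⬝ᵥ A *ᵥ x.ofLp
      = hH.eigenvalues i * ((b i).ofLp ⬝ᵥ x.ofLp) := by
    have hAT : Aᵀ = A := by simpa using hH.eq
    rw [dotProduct_mulVec, ← mulVec_transpose, hAT, hb, hH.mulVec_eigenvectorBasis,
      smul_dotProduct, smul_eq_mul]
  have hsum (w : En n) : x.ofLp ⬝ᵥ w.ofLp
      = ∑ i, ((b i).ofLp ⬝ᵥ x.ofLp) * ((b i).ofLp ⬝ᵥ w.ofLp) := by
    have := b.sum_inner_mul_inner x w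
    simp only [EuclideanSpace.inner_eq_star_dotProduct, star_trivial] at this
    rw [dotProduct_comm, ← this]
    refine Finset.sum_congr rfl fun i _ => ?_
    rw [dotProduct_comm w.ofLp]
  have hnorm : ‖x‖ ^ 2 = ∑ i, ((b i).ofLp ⬝ᵥ x.ofLp) ^ 2 := by
    rw [← real_inner_self_eq_norm_sq, EuclideanSpace.inner_eq_star_dotProduct, star_trivial, hsum x]
    exact Finset.sum_congr rfl fun i _ => (sq _).symm
  have hquad : x.ofLp ⬝ᵥ A *ᵥ x.ofLp
      = ∑ i, hH.eigenvalues i * ((b i).ofLp ⬝ᵥ x.ofLp) ^ 2 := by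
    rw [show A *ᵥ x.ofLp = (WithLp.toLp 2 (A *ᵥ x.ofLp) : En n).ofLp from rfl, hsum]
    refine Finset.sum_congr rfl fun i _ => ?_
    rw [hcoef]
    ring
  rw [hquad, hnorm, Finset.mul_sum, Finset.mul_sum]
  exact ⟨Finset.sum_le_sum fun i _ => mul_le_mul_of_nonneg_right (hev i).1 (sq_nonneg _),
    Finset.sum_le_sum fun i _ => mul_le_mul_of_nonneg_right (hev i).2 (sq_nonneg _)⟩

/-- The trace of a matrix in `PucciMatrices` lies in `[n * lam, n * Lam]`. -/
lemma PucciMatrices.trace_mem {n : ℕ} {lam Lam : ℝ} {A : Mat n}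
    (hA : A ∈ PucciMatrices n lam Lam) : n * lam ≤ A.trace ∧ A.trace ≤ n * Lam := by
  obtain ⟨hH, hev⟩ := hA
  rw [hH.trace_eq_sum_eigenvalues]
  have h₁ := Finset.sum_le_sum fun i (_ : i ∈ Finset.univ) => (hev i).1
  have h₂ := Finset.sum_le_sum fun i (_ : i ∈ Finset.univ) => (hev i).2
  simp only [Finset.sum_const, Finset.card_univ, Fintype.card_fin, nsmul_eq_mul] at h₁ h₂
  exact ⟨h₁, h₂⟩

/-- A symmetric matrix whose quadratic form is pinched between `lam` and `Lam` belongs to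
`PucciMatrices`. -/
lemma mem_pucciMatrices_of_forall {n : ℕ} {lam Lam : ℝ} {A : Mat n} (hH : A.IsHermitian)
    (h : ∀ x : En n, ‖x‖ = 1 →
      lam ≤ x.ofLp ⬝ᵥ A *ᵥ x.ofLp ∧ x.ofLp ⬝ᵥ A *ᵥ x.ofLp ≤ Lam) :
    A ∈ PucciMatrices n lam Lam := by
  refine ⟨hH, fun i => ?_⟩
  have hev : hH.eigenvalues i =
      (hH.eigenvectorBasis i).ofLp ⬝ᵥ A *ᵥ (hH.eigenvectorBasis i).ofLp := by
    simpa using hH.eigenvalues_eq i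
  rw [hev]
  exact h _ (hH.eigenvectorBasis.orthonormal.1 i)

lemma dotProduct_self_eq_norm_sq {n : ℕ} (x : En n) : x.ofLp ⬝ᵥ x.ofLp = ‖x‖ ^ 2 := by
  rw [← real_inner_self_eq_norm_sq, EuclideanSpace.inner_eq_star_dotProduct, star_trivial]

lemma dotProduct_rankOne_mulVec {n : ℕ} (p q : ℝ) (u x : En n) :
    x.ofLp ⬝ᵥ (p • (1 : Mat n) + (q - p) • vecMulVec u.ofLp u.ofLp) *ᵥ x.ofLp
      = p * ‖x‖ ^ 2 + (q - p) * (u.ofLp ⬝ᵥ x.ofLp) ^ 2 := by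
  rw [add_mulVec, smul_mulVec, smul_mulVec, one_mulVec, vecMulVec_mulVec, dotProduct_add,
    dotProduct_smul, dotProduct_smul, dotProduct_self_eq_norm_sq]
  simp only [op_smul_eq_smul, dotProduct_smul, smul_eq_mul, dotProduct_comm x.ofLp u.ofLp]
  ring

/-- The matrix with eigenvalue `q` along the unit vector `u` and `p` on its orthogonal
complement belongs to `PucciMatrices` when `p` and `q` lie in `[lam, Lam]`. -/
lemma rankOne_mem_pucciMatrices {n : ℕ} {lam Lam p q : ℝ} (hp : p ∈ Icc lam Lam)
    (hq : q ∈ Icc lam Lam) {u : En n} (hu : ‖u‖ = 1) :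
    p • (1 : Mat n) + (q - p) • vecMulVec u.ofLp u.ofLp ∈ PucciMatrices n lam Lam := by
  refine mem_pucciMatrices_of_forall ?_ fun x hx => ?_
  · ext i j
    simp [vecMulVec_apply, one_apply, eq_comm, mul_comm]
  · rw [dotProduct_rankOne_mulVec, hx]
    have h : (u.ofLp ⬝ᵥ x.ofLp) ^ 2 ≤ 1 := by
      have := abs_real_inner_le_norm x u
      rw [EuclideanSpace.inner_eq_star_dotProduct, star_trivial, hu, hx] at this
      rw [← sq_abs]
      nlinarith [abs_nonneg (u.ofLp ⬝ᵥ x.ofLp)]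
    have h0 := sq_nonneg (u.ofLp ⬝ᵥ x.ofLp)
    constructor <;> nlinarith [hp.1, hp.2, hq.1, hq.2]

lemma trace_rankOne {n : ℕ} (p q : ℝ) {u : En n} (hu : ‖u‖ = 1) :
    (p • (1 : Mat n) + (q - p) • vecMulVec u.ofLp u.ofLp).trace = (n - 1) * p + q := by
  rw [trace_add, trace_smul, trace_smul, trace_one, trace_vecMulVec,
    dotProduct_self_eq_norm_sq, hu]
  simp
  ring

lemma exists_unit_dotProduct_eq_norm {n : ℕ} (hn : 1 ≤ n) (y : En n) :
    ∃ u : En n, ‖u‖ = 1 ∧ u.ofLp ⬝ᵥ y.ofLp = ‖y‖ := by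
  rcases eq_or_ne y 0 with rfl | hy
  · exact ⟨EuclideanSpace.single ⟨0, hn⟩ 1, by simp, by simp⟩
  · have : ‖y‖ ≠ 0 := norm_ne_zero_iff.2 hy
    refine ⟨‖y‖⁻¹ • y, by simp [norm_smul, this], ?_⟩
    rw [WithLp.ofLp_smul, smul_dotProduct, dotProduct_self_eq_norm_sq, smul_eq_mul]
    field_simp

lemma hasFDerivAt_exp_mul_norm_sq {n : ℕ} (c : ℝ) (y : En n) :
    HasFDerivAt (fun z : En n => Real.exp (c * ‖z‖ ^ 2))
      ((2 * c * Real.exp (c * ‖y‖ ^ 2)) • innerSL ℝ y) y := by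
  refine ((hasStrictFDerivAt_norm_sq y).hasFDerivAt.const_mul c).exp.congr_fderiv ?_
  ext v
  simp
  ring

lemma fderiv_exp_mul_norm_sq {n : ℕ} (c : ℝ) (y v : En n) :
    fderiv ℝ (fun z : En n => Real.exp (c * ‖z‖ ^ 2)) y v
      = 2 * c * Real.exp (c * ‖y‖ ^ 2) * inner ℝ y v := by
  rw [(hasFDerivAt_exp_mul_norm_sq c y).fderiv]
  simp

lemma hess_exp_mul_norm_sq {n : ℕ} (c : ℝ) (y : En n) :
    hess n (fun z : En n => Real.exp (c * ‖z‖ ^ 2)) y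
      = Real.exp (c * ‖y‖ ^ 2) •
          ((4 * c ^ 2) • vecMulVec y.ofLp y.ofLp + (2 * c) • (1 : Mat n)) := by
  ext i j
  simp only [hess, of_apply, fderiv_exp_mul_norm_sq]
  have hj : HasFDerivAt (fun z : En n => inner ℝ z (EuclideanSpace.single j (1 : ℝ)))
      (innerSL ℝ (EuclideanSpace.single j (1 : ℝ))) y := by
    refine (innerSL ℝ (EuclideanSpace.single j (1 : ℝ) : En n)).hasFDerivAt.congr_of_eventuallyEq
      (.of_forall fun z => ?_)
    rw [innerSL_apply_apply, real_inner_comm]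
  rw [(((hasFDerivAt_exp_mul_norm_sq c y).const_mul (2 * c)).fun_mul hj).fderiv]
  simp [vecMulVec_apply, one_apply, EuclideanSpace.inner_single_right]
  split_ifs <;> ring

/-- The linear Pucci functional of the Hessian of a Gaussian. -/
lemma neg_trace_mul_hess {n : ℕ} (c : ℝ) (y : En n) (A : Mat n) :
    -(A * hess n (fun z : En n => Real.exp (c * ‖z‖ ^ 2)) y).trace
      = Real.exp (c * ‖y‖ ^ 2) *
          (-(2 * c) * A.trace - 4 * c ^ 2 * (y.ofLp ⬝ᵥ A *ᵥ y.ofLp)) := by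
  rw [hess_exp_mul_norm_sq, Matrix.mul_smul, mul_add, Matrix.mul_smul, Matrix.mul_smul, mul_one, mul_vecMulVec,
    trace_smul, trace_add, trace_smul, trace_smul, trace_vecMulVec, dotProduct_comm y.ofLp]
  simp only [smul_eq_mul]
  ring

/-- Bounds for the minimal Pucci operator applied to the Hessian of a Gaussian. -/
lemma pucciMinus_hess_mem {n : ℕ} (hn : 1 ≤ n) {lam Lam c : ℝ} (hLam : lam ≤ Lam) (hc : c ≤ 0)
    (y : En n) :
    PucciMinus n lam Lam (hess n (fun z : En n => Real.exp (c * ‖z‖ ^ 2)) y) ∈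
      Icc (Real.exp (c * ‖y‖ ^ 2) * (-(2 * c) * (n * lam) - 4 * c ^ 2 * (Lam * ‖y‖ ^ 2)))
        (Real.exp (c * ‖y‖ ^ 2) *
          (-(2 * c) * ((n - 1) * lam + Lam) - 4 * c ^ 2 * (Lam * ‖y‖ ^ 2))) := by
  obtain ⟨u, hu, huy⟩ := exists_unit_dotProduct_eq_norm hn y
  have hmem := mem_image_of_mem
    (fun A => -(A * hess n (fun z : En n => Real.exp (c * ‖z‖ ^ 2)) y).trace)
    (rankOne_mem_pucciMatrices ⟨le_rfl, hLam⟩ ⟨hLam, le_rfl⟩ hu)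
  have lower : Real.exp (c * ‖y‖ ^ 2) * (-(2 * c) * (n * lam) - 4 * c ^ 2 * (Lam * ‖y‖ ^ 2)) ∈
      lowerBounds ((fun A => -(A * hess n (fun z : En n => Real.exp (c * ‖z‖ ^ 2)) y).trace) ''
        PucciMatrices n lam Lam) := by
    rintro _ ⟨A, hA, rfl⟩
    simp only [neg_trace_mul_hess]
    have hc' : 0 ≤ -(2 * c) := by linarith
    gcongr
    exacts [(PucciMatrices.trace_mem hA).1, (PucciMatrices.dotProduct_mulVec_mem hA y).2]
  refine ⟨le_csInf ⟨_, hmem⟩ lower, (csInf_le ⟨_, lower⟩ hmem).trans_eq ?_⟩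
  simp only [neg_trace_mul_hess, trace_rankOne _ _ hu, dotProduct_rankOne_mulVec, huy]
  ring

/-- Bounds for the maximal Pucci operator applied to the Hessian of a Gaussian. -/
lemma pucciPlus_hess_mem {n : ℕ} (hn : 1 ≤ n) {lam Lam c : ℝ} (hLam : lam ≤ Lam) (hc : c ≤ 0)
    (y : En n) :
    PucciPlus n lam Lam (hess n (fun z : En n => Real.exp (c * ‖z‖ ^ 2)) y) ∈
      Icc (Real.exp (c * ‖y‖ ^ 2) *
          (-(2 * c) * ((n - 1) * Lam + lam) - 4 * c ^ 2 * (lam * ‖y‖ ^ 2)))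
        (Real.exp (c * ‖y‖ ^ 2) * (-(2 * c) * (n * Lam) - 4 * c ^ 2 * (lam * ‖y‖ ^ 2))) := by
  obtain ⟨u, hu, huy⟩ := exists_unit_dotProduct_eq_norm hn y
  have hmem := mem_image_of_mem
    (fun A => -(A * hess n (fun z : En n => Real.exp (c * ‖z‖ ^ 2)) y).trace)
    (rankOne_mem_pucciMatrices ⟨hLam, le_rfl⟩ ⟨le_rfl, hLam⟩ hu)
  have upper : Real.exp (c * ‖y‖ ^ 2) * (-(2 * c) * (n * Lam) - 4 * c ^ 2 * (lam * ‖y‖ ^ 2)) ∈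
      upperBounds ((fun A => -(A * hess n (fun z : En n => Real.exp (c * ‖z‖ ^ 2)) y).trace) ''
        PucciMatrices n lam Lam) := by
    rintro _ ⟨A, hA, rfl⟩
    simp only [neg_trace_mul_hess]
    have hc' : 0 ≤ -(2 * c) := by linarith
    gcongr
    exacts [(PucciMatrices.trace_mem hA).2, (PucciMatrices.dotProduct_mulVec_mem hA y).1]
  refine ⟨(le_csSup ⟨_, upper⟩ hmem).trans_eq' ?_, csSup_le ⟨_, hmem⟩ upper⟩
  simp only [neg_trace_mul_hess, trace_rankOne _ _ hu, dotProduct_rankOne_mulVec, huy]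
  ring

/-- **Lemma 3.4.** Pointwise bounds for the Gaussians `φ^a(y) = exp(-a|y|²)` under the Pucci
operators, for `a = 1/(4Λ)` (minimal operator) and `a = 1/(4λ)` (maximal operator). -/
theorem rugged_calculations (n : ℕ) (hn : 1 ≤ n) (lam Lam : ℝ)
    (hlam : 0 < lam) (hLam : lam ≤ Lam) :
    (∀ y : En n,
      ((n : ℝ) * lam / (2 * Lam)) * Real.exp (-(1/(4*Lam)) * ‖y‖ ^ 2) ≤
        PucciMinus n lam Lam (hess n (fun z : En n => Real.exp (-(1/(4*Lam)) * ‖z‖ ^ 2)) y)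
          - (1/2) * (fderiv ℝ (fun z : En n => Real.exp (-(1/(4*Lam)) * ‖z‖ ^ 2)) y y) ∧
      PucciMinus n lam Lam (hess n (fun z : En n => Real.exp (-(1/(4*Lam)) * ‖z‖ ^ 2)) y)
          - (1/2) * (fderiv ℝ (fun z : En n => Real.exp (-(1/(4*Lam)) * ‖z‖ ^ 2)) y y) ≤
        (((n : ℝ) - 1) * lam / (2 * Lam) + 1/2) * Real.exp (-(1/(4*Lam)) * ‖y‖ ^ 2)) ∧
    (∀ y : En n,
      (((n : ℝ) - 1) * Lam / (2 * lam) + 1/2) * Real.exp (-(1/(4*lam)) * ‖y‖ ^ 2) ≤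
        PucciPlus n lam Lam (hess n (fun z : En n => Real.exp (-(1/(4*lam)) * ‖z‖ ^ 2)) y)
          - (1/2) * (fderiv ℝ (fun z : En n => Real.exp (-(1/(4*lam)) * ‖z‖ ^ 2)) y y) ∧
      PucciPlus n lam Lam (hess n (fun z : En n => Real.exp (-(1/(4*lam)) * ‖z‖ ^ 2)) y)
          - (1/2) * (fderiv ℝ (fun z : En n => Real.exp (-(1/(4*lam)) * ‖z‖ ^ 2)) y y) ≤
        ((n : ℝ) * Lam / (2 * lam)) * Real.exp (-(1/(4*lam)) * ‖y‖ ^ 2)) := by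
  have hLam0 : 0 < Lam := hlam.trans_le hLam
  refine ⟨fun y => ?_, fun y => ?_⟩ <;>
    rw [fderiv_exp_mul_norm_sq, real_inner_self_eq_norm_sq]
  · obtain ⟨h₁, h₂⟩ := pucciMinus_hess_mem hn hLam
      (c := -(1 / (4 * Lam))) (by rw [neg_nonpos]; positivity) y
    constructor
    · refine le_trans (le_of_eq ?_) (sub_le_sub_right h₁ _)
      field_simp
      ring
    · refine (sub_le_sub_right h₂ _).trans (le_of_eq ?_)
      field_simp
      ring
  · obtain ⟨h₁, h₂⟩ := pucciPlus_hess_mem hn hLam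
      (c := -(1 / (4 * lam))) (by rw [neg_nonpos]; positivity) y
    constructor
    · refine le_trans (le_of_eq ?_) (sub_le_sub_right h₁ _)
      field_simp
      ring
    · refine (sub_le_sub_right h₂ _).trans (le_of_eq ?_)
      field_simp
      ring
end
end
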